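/- Let p ≥ 5 be a prime and let q = p^a for some a ≥ 1, and let S = PSL_3(q) be the quotient of SL_3(F_q) by its center, where F_q is the finite field with q elements. Then there exist irreducible complex characters χ_1 and χ_2 of S with χ_1(1) = (q + 1)(q² + q + 1) and χ_2(1) = (q − 1)(q² + q + 1) (both coprime to p), such that χ_1 extends to Aut(S) and χ_2 is invariant under every automorphism of S of p-power order. -/

import Mathlib

open CategoryTheory

/-- The projective special linear group `PSL_n(F_q)` with `q = p^a`, defined as
`SL_n(F_q)` modulo its center, where `F_q = GaloisField p a` is the field with `p^a` elements. -/
abbrev PSL (n p a : ℕ) [Fact p.Prime] : Type :=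
  Matrix.SpecialLinearGroup (Fin n) (GaloisField p a) ⧸
    Subgroup.center (Matrix.SpecialLinearGroup (Fin n) (GaloisField p a))

set_option linter.unusedSectionVars false
set_option linter.unusedSimpArgs false

theorem irr_lin {G V : Type} [Group G] [AddCommGroup V] [Module ℂ V]
    (ρ : Representation ℂ G V) {Q : Type} [Group Q] [Finite Q] (i : Q →* G) (Ψ : Q →* ℂˣ)
    (ev : V →ₗ[ℂ] ℂ) (h1 : ∀ v, (∀ x, ρ (i x) v = (Ψ x : ℂ) • v) → ev v = 0 → v = 0)
    (h2 : ∀ v, v ≠ 0 → ∃ g, ev (ρ g v) ≠ 0)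
    (h3 : ∀ x v, ev (ρ (i x) v) = (Ψ x : ℂ) * ev v) (hV : Nontrivial V)
    (f : V →ₗ[ℂ] V) (hf : ∀ g v, f (ρ g v) = ρ g (f v)) : ∃ c : ℂ, ∀ v, f v = c • v := by
  classical
  have := Fintype.ofFinite Q
  let e : V →ₗ[ℂ] V := ∑ x : Q, ((Ψ x : ℂ)⁻¹) • ρ (i x)
  have he : ∀ v, e v = ∑ x : Q, ((Ψ x : ℂ)⁻¹) • ρ (i x) v := by
    intro v; simp [e, LinearMap.sum_apply]
  have e1 : ∀ v y, ρ (i y) (e v) = (Ψ y : ℂ) • e v := by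
    intro v y
    rw [he, map_sum, Finset.smul_sum]
    refine Fintype.sum_equiv (Equiv.mulLeft y) _ _ (fun x => ?_)
    simp only [Equiv.coe_mulLeft, map_mul, map_smul, Module.End.mul_apply, Units.val_mul, smul_smul, mul_inv]
    rw [← mul_assoc, mul_inv_cancel₀ (Units.ne_zero _), one_mul]
  have e2 : ∀ v, ev (e v) = (Fintype.card Q : ℂ) * ev v := by
    intro v
    rw [he, map_sum]
    simp [h3]
  have e3 : ∀ v, f (e v) = e (f v) := by
    intro v; simp [he, hf]
  have hc : (Fintype.card Q : ℂ) ≠ 0 := by simp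
  obtain ⟨v, hv⟩ := exists_ne (0 : V)
  obtain ⟨g, hg⟩ := h2 v hv
  set e0 := e (ρ g v) with he0
  have ee0 : ev e0 ≠ 0 := by rw [he0, e2]; exact mul_ne_zero hc hg
  have span : ∀ w, (∀ x, ρ (i x) w = (Ψ x : ℂ) • w) → w = (ev w / ev e0) • e0 := by
    intro w hw
    rw [← sub_eq_zero]
    apply h1
    · intro x
      rw [map_sub, map_smul, hw, he0, e1, smul_sub, smul_comm]
    · rw [map_sub, map_smul, smul_eq_mul, div_mul_cancel₀ _ ee0, sub_self]
  have hfe : f e0 = (ev (f e0) / ev e0) • e0 := by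
    apply span
    intro x
    rw [he0, e3, e1]
  refine ⟨(ev (f e0) / ev e0), fun w => ?_⟩
  set c := (ev (f e0) / ev e0)
  by_contra hne
  obtain ⟨k, hk⟩ := h2 (f w - c • w) (sub_ne_zero.2 hne)
  have a1 : e (ρ k w) = (ev (e (ρ k w)) / ev e0) • e0 := span _ (e1 _)
  have a2 : f (e (ρ k w)) - c • e (ρ k w) = 0 := by
    rw [a1, map_smul, hfe, smul_comm, sub_self]
  have a3 : f (e (ρ k w)) - c • e (ρ k w) = e (ρ k (f w - c • w)) := by
    rw [e3, hf, map_sub, map_sub, map_smul, map_smul]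
  rw [a3] at a2
  have := e2 (ρ k (f w - c • w))
  rw [a2, map_zero] at this
  exact mul_ne_zero hc hk this.symm

theorem irr_of_ev {G V : Type} [Group G] [Finite G] [AddCommGroup V] [Module ℂ V] [Module.Finite ℂ V]
    (ρ : Representation ℂ G V) {Q : Type} [Group Q] [Finite Q] (i : Q →* G) (Ψ : Q →* ℂˣ)
    (ev : V →ₗ[ℂ] ℂ) (h1 : ∀ v, (∀ x, ρ (i x) v = (Ψ x : ℂ) • v) → ev v = 0 → v = 0)
    (h2 : ∀ v, v ≠ 0 → ∃ g, ev (ρ g v) ≠ 0)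
    (h3 : ∀ x v, ev (ρ (i x) v) = (Ψ x : ℂ) * ev v) (hV : Nontrivial V) :
    Simple (FDRep.of ρ) := by
  rw [FDRep.simple_iff_end_is_rank_one]
  have h0 : (𝟙 (FDRep.of ρ)) ≠ 0 := by
    intro h
    obtain ⟨v, hv⟩ := exists_ne (0 : V)
    apply hv
    have := congrArg (fun f : FDRep.of ρ ⟶ FDRep.of ρ => f.hom.hom.hom v) h
    exact this
  rw [finrank_eq_one_iff_of_nonzero' _ h0]
  intro f
  obtain ⟨c, hc⟩ := irr_lin ρ i Ψ ev h1 h2 h3 hV f.hom.hom.hom (by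
    intro g v
    have := f.comm g
    have := congrArg (fun k => k.hom.hom v) this
    exact this)
  refine ⟨c, ?_⟩
  ext v
  exact (hc v).symm

/-- dimension of coinduced -/
theorem coind_finrank {H A W : Type} [Group H] [Group A] [Finite A] [AddCommGroup W] [Module ℂ W]
    [Module.Finite ℂ W]
    (m : H →* A) (τ : Representation ℂ H W) (W0 : Submodule ℂ W)
    (hW0 : ∀ w, w ∈ W0 ↔ ∀ h, m h = 1 → τ h w = w) :
    Module.finrank ℂ (Representation.coindV m τ) = m.range.index * Module.finrank ℂ W0 := by
  classical
  let X := Quotient (QuotientGroup.rightRel m.range)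
  have hex : ∀ a : A, ∃ h : H, m h * (Quotient.mk (QuotientGroup.rightRel m.range) a).out = a := by
    intro a
    have := Quotient.mk_out (s := QuotientGroup.rightRel m.range) a
    have h2 := QuotientGroup.rightRel_apply.1 this
    obtain ⟨h, hh⟩ := h2
    exact ⟨h, by rw [hh]; group⟩
  choose s hs using hex
  have inv : ∀ h (w : W), τ h⁻¹ (τ h w) = w := by
    intro h w
    rw [← Module.End.mul_apply, ← map_mul]; simp
  have wd : ∀ (w : W0) h h', m h = m h' → τ h w = τ h' w := by
    intro w h h' e
    have := (hW0 w).1 w.2 (h⁻¹ * h') (by simp [e])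
    calc τ h w = τ h (τ (h⁻¹ * h') w) := by rw [this]
      _ = τ h' w := by rw [← Module.End.mul_apply, ← map_mul]; simp
  let Φ : Representation.coindV m τ ≃ₗ[ℂ] (X → W0) :=
    { toFun := fun f x => ⟨f.1 x.out, (hW0 _).2 (fun h hh => by
        rw [← f.2 h, hh, one_mul])⟩
      map_add' := fun f g => rfl
      map_smul' := fun c f => rfl
      invFun := fun u => ⟨fun a => τ (s a) (u (Quotient.mk _ a)), fun h a => by
        rw [← Module.End.mul_apply, ← map_mul]
        have e : (Quotient.mk (QuotientGroup.rightRel m.range) (m h * a)) = Quotient.mk _ a := by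
          apply Quotient.sound
          apply QuotientGroup.rightRel_apply.2
          exact ⟨h⁻¹, by simp⟩
        beta_reduce
        rw [e]
        apply wd
        have h1 := hs (m h * a)
        have h2 := hs a
        rw [e] at h1
        rw [map_mul]
        exact mul_right_cancel (h1.trans (by rw [mul_assoc, h2]))⟩
      left_inv := fun f => by
        ext a
        show τ (s a) (f.1 _) = f.1 a
        rw [← f.2, hs]
      right_inv := fun u => by
        ext x
        show τ (s x.out) (u (Quotient.mk _ x.out)) = u x
        rw [Quotient.out_eq]
        apply (hW0 _).1 (u x).2
        have := hs x.out
        rw [Quotient.out_eq] at this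
        simpa using this }
  rw [Φ.finrank_eq]
  have : Fintype X := Fintype.ofFinite X
  rw [Module.finrank_pi_fintype]
  simp only [Finset.sum_const, Finset.card_univ, smul_eq_mul]
  congr 1
  rw [Subgroup.index, ← Nat.card_eq_fintype_card]
  exact Nat.card_congr (QuotientGroup.quotientRightRelEquivQuotientLeftRel _)


section Weil

variable {F E : Type} [Field F] [Fintype F] [Field E] [Fintype E] [Algebra F E]

/-- conjugation of the quadratic extension -/
noncomputable def cjE (F : Type) {E : Type} [Field F] [Fintype F] [Field E] [Algebra F E] (z : E) : E :=
  z ^ Fintype.card F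

theorem cj_add (z w : E) : cjE F (z + w) = cjE F z + cjE F w := by
  have := map_add (FiniteField.frobeniusAlgHom F E) z w
  simpa [cjE] using this

theorem cj_mul (z w : E) : cjE F (z * w) = cjE F z * cjE F w := mul_pow _ _ _

theorem cj_alg (c : F) : cjE F (algebraMap F E c) = algebraMap F E c := by
  rw [cjE, ← map_pow, FiniteField.pow_card]

variable (h2 : Module.finrank F E = 2)
include h2

theorem alg_norm (z : E) : algebraMap F E (Algebra.norm F z) = z * cjE F z := by
  rw [FiniteField.algebraMap_norm_eq_prod_pow, h2]
  simp [Finset.prod_range_succ, cjE, Nat.card_eq_fintype_card]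

theorem alg_trace (z : E) : algebraMap F E (Algebra.trace F E z) = z + cjE F z := by
  rw [FiniteField.algebraMap_trace_eq_sum_pow, h2]
  simp [Finset.sum_range_succ, cjE, Nat.card_eq_fintype_card]

theorem card_E : Fintype.card E = Fintype.card F ^ 2 := by
  rw [← h2]; exact Module.card_eq_pow_finrank

theorem cj_cj (z : E) : cjE F (cjE F z) = z := by
  rw [cjE, cjE, ← pow_mul, ← sq, ← card_E h2, FiniteField.pow_card]

theorem norm_add_q (z w : E) : Algebra.norm F (z + w) =
    Algebra.norm F z + Algebra.norm F w + Algebra.trace F E (z * cjE F w) := by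
  apply (algebraMap F E).injective
  simp only [map_add, alg_norm h2, alg_trace h2, cj_add, cj_mul, cj_cj h2]
  ring

theorem trace_cj (z : E) : Algebra.trace F E (cjE F z) = Algebra.trace F E z := by
  apply (algebraMap F E).injective
  simp only [alg_trace h2, cj_cj h2]
  ring

theorem trace_swap (z w : E) : Algebra.trace F E (z * cjE F w) = Algebra.trace F E (w * cjE F z) := by
  rw [← trace_cj h2, cj_mul, cj_cj h2, mul_comm]

theorem trace_self (z : E) : Algebra.trace F E (z * cjE F z) = 2 * Algebra.norm F z := by
  apply (algebraMap F E).injective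
  simp only [alg_trace h2, alg_norm h2, cj_mul, cj_cj h2, map_mul, map_ofNat]
  ring

omit h2 in
theorem trace_smulF (c : F) (z : E) : Algebra.trace F E (algebraMap F E c * z) = c * Algebra.trace F E z := by
  rw [← Algebra.smul_def, map_smul, smul_eq_mul]

theorem norm_algF (c : F) : Algebra.norm F (algebraMap F E c) = c ^ 2 := by
  rw [Algebra.norm_algebraMap, h2]

theorem sum_lin (ψ : AddChar F ℂ) (hψ : ψ ≠ 1) (y : E) (hy : y ≠ 0) :
    ∑ w : E, ψ (-Algebra.trace F E (y * cjE F w)) = 0 := by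
  classical
  let χ : AddChar E ℂ := ψ.compAddMonoidHom (Algebra.trace F E).toAddMonoidHom
  have hχ : χ ≠ 1 := by
    intro h
    apply hψ
    ext x
    obtain ⟨z, hz⟩ := Algebra.trace_surjective F E x
    have := DFunLike.congr_fun h z
    simpa [χ, hz] using this
  have hp := AddChar.IsPrimitive.of_ne_one hχ
  have := AddChar.sum_mulShift (-y) hp
  rw [if_neg (neg_ne_zero.2 hy)] at this
  rw [Nat.cast_zero] at this
  rw [← this]
  refine Fintype.sum_equiv (Function.Involutive.toPerm (cjE F) (cj_cj h2)) _ _ (fun w => ?_)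
  show ψ (-Algebra.trace F E (y * cjE F w)) = ψ (Algebra.trace F E (cjE F w * -y))
  rw [mul_neg, map_neg (Algebra.trace F E), mul_comm]

theorem gauss (ψ : AddChar F ℂ) (hψ : ψ ≠ 1) (k : F) (hk : k ≠ 0) :
    ∑ w : E, ψ (k * Algebra.norm F w) = -(Fintype.card F : ℂ) := by
  classical
  have indep : ∀ k : F, k ≠ 0 → ∑ w : E, ψ (k * Algebra.norm F w) = ∑ w : E, ψ (Algebra.norm F w) := by
    intro k hk
    obtain ⟨t, ht⟩ := FiniteField.norm_surjective F E k
    have ht0 : t ≠ 0 := by rintro rfl; simp at ht; exact hk ht.symm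
    refine Fintype.sum_equiv (Equiv.mulLeft₀ t ht0) _ _ (fun w => ?_)
    simp [ht]
  rw [indep k hk]
  have hp := AddChar.IsPrimitive.of_ne_one hψ
  have tot : ∑ k : F, ∑ w : E, ψ (k * Algebra.norm F w) = (Fintype.card F : ℂ) := by
    rw [Finset.sum_comm]
    rw [Finset.sum_eq_single 0]
    · simp
    · intro w _ hw
      rw [AddChar.sum_mulShift _ hp, if_neg]
      · simp
      · simpa [Algebra.norm_eq_zero_iff] using hw
    · simp
  rw [← Finset.add_sum_erase _ _ (Finset.mem_univ (0 : F))] at tot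
  rw [Finset.sum_congr rfl (fun k hk => indep k (Finset.ne_of_mem_erase hk))] at tot
  simp only [zero_mul, AddChar.map_zero_eq_one, Finset.sum_const, Finset.card_univ, smul_eq_mul,
    Finset.card_erase_of_mem (Finset.mem_univ _), nsmul_eq_mul, mul_one, card_E h2] at tot
  have h1 : 1 < Fintype.card F := Fintype.one_lt_card
  rw [Nat.cast_sub h1.le] at tot
  push_cast at tot
  have h3 : ((Fintype.card F : ℂ) - 1) ≠ 0 := by
    rw [sub_ne_zero]; exact_mod_cast h1.ne'
  apply mul_left_cancel₀ h3
  linear_combination tot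

theorem gauss_lin (ψ : AddChar F ℂ) (hψ : ψ ≠ 1) (k : F) (hk : k ≠ 0) (y : E) :
    ∑ w : E, ψ (k * Algebra.norm F w - Algebra.trace F E (y * cjE F w)) =
      -(Fintype.card F : ℂ) * ψ (-Algebra.norm F y / k) := by
  rw [← gauss h2 ψ hψ k hk, Finset.sum_mul]
  refine Fintype.sum_equiv (Equiv.subRight (algebraMap F E k⁻¹ * y)) _ _ (fun w => ?_)
  rw [← AddChar.map_add_eq_mul]
  congr 1
  simp only [Equiv.subRight_apply]
  rw [sub_eq_add_neg w, norm_add_q h2, ← neg_mul, ← map_neg, map_mul (Algebra.norm F), norm_algF h2, cj_mul, cj_alg,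
    mul_left_comm, trace_smulF, trace_swap h2 w y]
  field_simp
  ring

end Weil


section Weil2

variable {F E : Type} [Field F] [Fintype F] [DecidableEq F] [Field E] [Fintype E] [Algebra F E]

/-- the Weil operators -/
noncomputable def wr (ψ : AddChar F ℂ) (g : Matrix (Fin 2) (Fin 2) F) (t : E) :
    (E → ℂ) →ₗ[ℂ] (E → ℂ) where
  toFun f z := if g 1 0 = 0 then
      ψ (g 0 1 / g 1 1 * Algebra.norm F z) * f (z * t * algebraMap F E (g 1 1)⁻¹)
    else -(Fintype.card F : ℂ)⁻¹ * ∑ w : E, ψ ((g 0 0 * Algebra.norm F z -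
      Algebra.trace F E (z * t * cjE F w) + g 1 1 * Algebra.norm F w) / g 1 0) * f w
  map_add' f f' := by
    ext z
    split_ifs with h <;> simp [h, mul_add, Finset.sum_add_distrib]
  map_smul' c f := by
    ext z
    split_ifs with h
    · simp [h]; ring
    · simp [h, Finset.mul_sum]
      refine Finset.sum_congr rfl fun w _ => by ring

theorem wr_zero (ψ : AddChar F ℂ) (g : Matrix (Fin 2) (Fin 2) F) (t : E) {b d : F} (hb : g 0 1 = b)
    (hd : g 1 1 = d) (h : g 1 0 = 0)
    (f : E → ℂ) (z : E) : wr ψ g t f z =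
      ψ (b / d * Algebra.norm F z) * f (z * t * algebraMap F E d⁻¹) := by
  subst hb hd
  simp [wr, h]

theorem wr_ne (ψ : AddChar F ℂ) (g : Matrix (Fin 2) (Fin 2) F) (t : E) {a c d : F} (ha : g 0 0 = a)
    (hcc : g 1 0 = c) (hd : g 1 1 = d) (h : c ≠ 0)
    (f : E → ℂ) (z : E) : wr ψ g t f z =
      -(Fintype.card F : ℂ)⁻¹ * ∑ w : E, ψ ((a * Algebra.norm F z -
      Algebra.trace F E (z * t * cjE F w) + d * Algebra.norm F w) / c) * f w := by
  subst ha hd hcc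
  simp [wr, h]

variable (h2 : Module.finrank F E = 2)
include h2

theorem wr_mul (ψ : AddChar F ℂ) (hψ : ψ ≠ 1) (g g' : Matrix (Fin 2) (Fin 2) F) (t t' : E)
    (hd : g.det = Algebra.norm F t) (hd' : g'.det = Algebra.norm F t') (ht : t ≠ 0) (ht' : t' ≠ 0)
    (f : E → ℂ) : wr ψ (g * g') (t * t') f = wr ψ g t (wr ψ g' t' f) := by
  classical
  have hN : Algebra.norm F t ≠ 0 := by simpa [Algebra.norm_eq_zero_iff] using ht
  have hN' : Algebra.norm F t' ≠ 0 := by simpa [Algebra.norm_eq_zero_iff] using ht'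
  have e00 : (g * g') 0 0 = g 0 0 * g' 0 0 + g 0 1 * g' 1 0 := by simp [Matrix.mul_apply, Fin.sum_univ_two]
  have e01 : (g * g') 0 1 = g 0 0 * g' 0 1 + g 0 1 * g' 1 1 := by simp [Matrix.mul_apply, Fin.sum_univ_two]
  have e10 : (g * g') 1 0 = g 1 0 * g' 0 0 + g 1 1 * g' 1 0 := by simp [Matrix.mul_apply, Fin.sum_univ_two]
  have e11 : (g * g') 1 1 = g 1 0 * g' 0 1 + g 1 1 * g' 1 1 := by simp [Matrix.mul_apply, Fin.sum_univ_two]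
  rw [Matrix.det_fin_two] at hd hd'
  generalize hg'' : g * g' = g'' at *
  generalize ka : g 0 0 = a at *
  generalize kb : g 0 1 = b at *
  generalize kc : g 1 0 = c at *
  generalize kd : g 1 1 = d at *
  generalize ka' : g' 0 0 = a' at *
  generalize kb' : g' 0 1 = b' at *
  generalize kc' : g' 1 0 = c' at *
  generalize kd' : g' 1 1 = d' at *
  generalize ka'' : g'' 0 0 = a'' at *
  generalize kb'' : g'' 0 1 = b'' at *
  generalize kc'' : g'' 1 0 = c'' at *
  generalize kd'' : g'' 1 1 = d'' at *
  have hq : (Fintype.card F : ℂ) ≠ 0 := by simp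
  ext z
  by_cases hc : c = 0
  · have hd0 : d ≠ 0 := by rintro h; rw [h, hc] at hd; apply hN; rw [← hd]; ring
    have ha0 : a ≠ 0 := by rintro h; rw [h, hc] at hd; apply hN; rw [← hd]; ring
    rw [hc] at hd
    rw [wr_zero ψ g t kb kd (kc.trans hc)]
    by_cases hc' : c' = 0
    · have hd0' : d' ≠ 0 := by rintro h; rw [h, hc'] at hd'; apply hN'; rw [← hd']; ring
      rw [wr_zero ψ g' t' kb' kd' (kc'.trans hc'), wr_zero ψ g'' _ kb'' kd'' (by rw [kc'', e10, hc, hc']; ring), ← mul_assoc (ψ _), ← AddChar.map_add_eq_mul]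
      congr 2
      · rw [e01, e11, hc]
        simp only [map_mul, norm_algF h2, ← hd]
        field_simp
        ring
      · rw [e11, hc]
        simp only [zero_mul, zero_add, mul_inv, map_mul]
        ring
    · rw [wr_ne ψ g' t' ka' kc' kd' hc', wr_ne ψ g'' _ ka'' kc'' kd'' (by rw [e10, hc]; simp [hd0, hc'])]
      rw [mul_left_comm (ψ _)]
      congr 1
      rw [Finset.mul_sum]
      refine Finset.sum_congr rfl fun w _ => ?_
      rw [← mul_assoc (ψ _), ← AddChar.map_add_eq_mul]
      congr 2
      have : z * t * (algebraMap F E) d⁻¹ * t' * cjE F w = (algebraMap F E) d⁻¹ * (z * (t * t') * cjE F w) := by ring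
      rw [this, trace_smulF, e00, e11, e10, hc]
      simp only [map_mul, norm_algF h2, ← hd]
      field_simp
      ring
  · rw [wr_ne ψ g t ka kc kd hc]
    by_cases hc' : c' = 0
    · have hd0' : d' ≠ 0 := by rintro h; rw [h, hc'] at hd'; apply hN'; rw [← hd']; ring
      have ha0' : a' ≠ 0 := by rintro h; rw [h, hc'] at hd'; apply hN'; rw [← hd']; ring
      rw [hc'] at hd'
      rw [wr_ne ψ g'' _ ka'' kc'' kd'' (by rw [e10, hc']; simp [hc, ha0'])]
      congr 1
      have hs : t' * algebraMap F E d'⁻¹ ≠ 0 := by simp [ht', hd0']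
      symm
      refine Fintype.sum_equiv (Equiv.mulRight₀ (t' * algebraMap F E d'⁻¹) hs) _ _ (fun w => ?_)
      rw [wr_zero ψ g' t' kb' kd' (kc'.trans hc'), ← mul_assoc (ψ _), ← AddChar.map_add_eq_mul, Equiv.mulRight₀_apply]
      congr 2
      · have : z * (t * t') * cjE F (w * (t' * algebraMap F E d'⁻¹)) = 
          algebraMap F E (Algebra.norm F t' * d'⁻¹) * (z * t * cjE F w) := by
          rw [map_mul, alg_norm h2, cj_mul, cj_mul, cj_alg]; ring
        rw [this, trace_smulF, e00, e11, e10, hc']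
        simp only [map_mul, norm_algF h2, ← hd']
        field_simp
        ring
      · ring
    · have inner : wr ψ g' t' f = fun w => -(Fintype.card F : ℂ)⁻¹ * ∑ v : E, ψ ((a' * Algebra.norm F w -
          Algebra.trace F E (w * t' * cjE F v) + d' * Algebra.norm F v) / c') * f v := by
        ext w; rw [wr_ne ψ g' t' ka' kc' kd' hc']
      rw [inner]
      simp only []
      have y (v : E) : ∃ y : E, y = algebraMap F E c⁻¹ * (z * t) + algebraMap F E c'⁻¹ * (cjE F t' * v) := ⟨_, rfl⟩
      choose y hy using y
      have swap : ∑ w : E, ψ ((a * Algebra.norm F z -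
          Algebra.trace F E (z * t * cjE F w) + d * Algebra.norm F w) / c) * (-(Fintype.card F : ℂ)⁻¹ * ∑ v : E, ψ ((a' * Algebra.norm F w -
          Algebra.trace F E (w * t' * cjE F v) + d' * Algebra.norm F v) / c') * f v)
          = -(Fintype.card F : ℂ)⁻¹ * ∑ v : E, (ψ (a * Algebra.norm F z / c + d' * Algebra.norm F v / c') * 
            ∑ w : E, ψ ((d / c + a' / c') * Algebra.norm F w - Algebra.trace F E (y v * cjE F w))) * f v := by
        simp only [Finset.mul_sum, Finset.sum_mul]
        rw [Finset.sum_comm]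
        refine Finset.sum_congr rfl fun v _ => Finset.sum_congr rfl fun w _ => ?_
        rw [mul_left_comm, ← mul_assoc (ψ _), ← AddChar.map_add_eq_mul, ← AddChar.map_add_eq_mul]
        congr 3
        have : w * t' * cjE F v = w * cjE F (cjE F t' * v) := by rw [cj_mul, cj_cj h2]; ring
        rw [this, trace_swap h2 w, hy, add_mul (algebraMap F E _ * _), map_add (Algebra.trace F E), mul_assoc (algebraMap F E _), trace_smulF, mul_assoc (algebraMap F E _), trace_smulF]
        field_simp
        ring
      rw [swap]
      by_cases hc'' : c'' = 0
      · have hk : d / c + a' / c' = 0 := by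
          rw [e10] at hc''; field_simp; linear_combination hc''
        simp only [hk, zero_mul, zero_sub]
        have hdet : d'' * c' = - c * Algebra.norm F t' := by
          rw [e11, ← hd']; rw [e10] at hc''; linear_combination d' * hc''
        have hd0 : d'' ≠ 0 := by
          intro h; rw [h, zero_mul] at hdet; exact mul_ne_zero (neg_ne_zero.2 hc) hN' hdet.symm
        set v0 := z * (t * t') * algebraMap F E (d'')⁻¹ with hv0
        have cjt : cjE F t' * t' = algebraMap F E (Algebra.norm F t') := by rw [alg_norm h2]; ring
        have cjt0 : cjE F t' ≠ 0 := by
          intro h; rw [h, zero_mul] at cjt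
          have := (map_eq_zero (algebraMap F E)).1 cjt.symm; exact hN' this
        have yv0 : y v0 = 0 := by
          rw [hy, hv0]
          have : algebraMap F E c'⁻¹ * (cjE F t' * (z * (t * t') * algebraMap F E (d'')⁻¹)) =
            algebraMap F E (c'⁻¹ * (Algebra.norm F t') * (d'')⁻¹) * (z * t) := by
            rw [map_mul, map_mul, ← cjt]; ring
          rw [this, ← add_mul, ← map_add]
          have : c⁻¹ + c'⁻¹ * Algebra.norm F t' * (d'')⁻¹ = 0 := by
            field_simp; linear_combination hdet
          rw [this]; simp
        have yne : ∀ v, v ≠ v0 → y v ≠ 0 := by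
          intro v hv h
          apply hv
          have h3 := h.trans yv0.symm
          rw [hy, hy] at h3
          have h4 := mul_left_cancel₀ (by simpa using hc') (add_left_cancel h3)
          exact mul_left_cancel₀ cjt0 h4
        rw [Finset.sum_eq_single v0 (fun v _ hv => by rw [sum_lin h2 ψ hψ _ (yne v hv)]; simp) (by simp)]
        rw [yv0]
        simp only [zero_mul, map_zero, neg_zero, AddChar.map_zero_eq_one, Finset.sum_const, Finset.card_univ,
          nsmul_eq_mul, card_E h2, mul_one]
        rw [wr_zero ψ g'' _ kb'' kd'' (kc''.trans hc'')]
        have : ψ (b'' / d'' * Algebra.norm F z) = ψ (a * Algebra.norm F z / c + d' * Algebra.norm F v0 / c') := by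
          congr 1
          have hdd : (a * d - b * c) * (a' * d' - b' * c') = a'' * d'' := by
            rw [e00, e11]; rw [e10] at hc''; linear_combination (-(a * b' + b * d')) * hc''
          have hNv : Algebra.norm F v0 = Algebra.norm F z * (a'' / d'') := by
            rw [hv0, map_mul, map_mul, map_mul, norm_algF h2, ← hd, ← hd', hdd]
            field_simp
          rw [hNv]
          rw [e10] at hc''
          field_simp
          rw [e00, e01, e11]
          linear_combination (-(Algebra.norm F z) * a * d') * hc''
        rw [this, ← hv0]
        push_cast
        field_simp
      · have hk : d / c + a' / c' ≠ 0 := by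
          rw [e10] at hc''; 
          intro h; apply hc''; field_simp at h; linear_combination h
        simp only [gauss_lin h2 ψ hψ _ hk]
        rw [wr_ne ψ g'' _ ka'' kc'' kd'' hc'']
        rw [Finset.mul_sum, Finset.mul_sum, Finset.mul_sum]
        refine Finset.sum_congr rfl fun v _ => ?_
        have : ψ ((a'' * Algebra.norm F z - Algebra.trace F E (z * (t * t') * cjE F v) +
            d'' * Algebra.norm F v) / c'') = ψ (a * Algebra.norm F z / c + d' * Algebra.norm F v / c') *
            ψ (-Algebra.norm F (y v) / (d / c + a' / c')) := by
          rw [← AddChar.map_add_eq_mul]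
          congr 1
          have : (algebraMap F E) c⁻¹ * (z * t) * cjE F ((algebraMap F E) c'⁻¹ * (cjE F t' * v))
            = algebraMap F E (c⁻¹ * c'⁻¹) * (z * (t * t') * cjE F v) := by
            rw [cj_mul, cj_mul, cj_alg, cj_cj h2, map_mul]; ring
          have nc : Algebra.norm F (cjE F t') = Algebra.norm F t' := by
            apply (algebraMap F E).injective
            rw [alg_norm h2, alg_norm h2, cj_cj h2, mul_comm]
          have hk2 : d / c + a' / c' = c'' / (c * c') := by
            rw [e10]; field_simp; ring
          rw [hy, norm_add_q h2, this, trace_smulF]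
          simp only [map_mul, norm_algF h2, nc, ← hd, ← hd']
          rw [hk2, e00, e11]
          field_simp
          rw [e10]
          ring
        rw [this]
        field_simp

end Weil2


section Basics

abbrev G3 (F : Type) [Field F] : Type := Matrix.SpecialLinearGroup (Fin 3) F
abbrev PS (F : Type) [Field F] : Type := G3 F ⧸ Subgroup.center (G3 F)

variable {F : Type} [Field F]

abbrev mk3 : G3 F →* PS F := QuotientGroup.mk' _

theorem mk3_surj (s : PS F) : ∃ g, mk3 g = s := QuotientGroup.mk'_surjective _ s

theorem mk3_eq {x y : G3 F} : mk3 x = mk3 y ↔ ∃ r : F, r ^ 3 = 1 ∧ ∀ i j, y i j = r * x i j := by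
  have : mk3 x = mk3 y ↔ x⁻¹ * y ∈ Subgroup.center (G3 F) := by
    exact QuotientGroup.eq
  rw [this, Matrix.SpecialLinearGroup.mem_center_iff]
  refine exists_congr fun r => and_congr (by simp) ?_
  constructor
  · intro h i j
    have h1 : (y : Matrix (Fin 3) (Fin 3) F) = x.1 * (Matrix.scalar (Fin 3) r) := by
      rw [h, ← Matrix.SpecialLinearGroup.coe_mul]; simp
    have := congrFun (congrFun h1 i) j
    rw [Matrix.scalar_apply, Matrix.mul_diagonal] at this
    rw [mul_comm]; exact this
  · intro h
    have : y.1 = x.1 * (Matrix.scalar (Fin 3) r) := by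
      ext i j
      rw [Matrix.scalar_apply, Matrix.mul_diagonal, mul_comm]; exact h i j
    rw [Matrix.SpecialLinearGroup.coe_mul]
    show _ = (x⁻¹).1 * y.1
    rw [this, ← Matrix.mul_assoc, ← Matrix.SpecialLinearGroup.coe_mul]; simp

theorem mk3_inj {x y : G3 F} (h3 : (3 : F) ≠ 0) (hx : x.1.trace = 3) (hy : y.1.trace = 3)
    (h : mk3 x = mk3 y) : x = y := by
  obtain ⟨r, -, hr⟩ := mk3_eq.1 h
  have : r = 1 := by
    have h1 : y.1.trace = r * x.1.trace := by
      simp only [Matrix.trace, Finset.mul_sum, Matrix.diag_apply]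
      exact Finset.sum_congr rfl fun i _ => hr i i
    rw [hx, hy] at h1
    exact (mul_right_cancel₀ h3 (by rw [one_mul]; exact h1)).symm
  ext i j
  show x i j = y i j
  rw [hr, this, one_mul]

/-- unitriangular element -/
def un (a b c : F) : G3 F := ⟨!![1, a, b; 0, 1, c; 0, 0, 1], by simp [Matrix.det_fin_three]⟩

theorem un_mul (a b c a' b' c' : F) : un a b c * un a' b' c' = un (a + a') (b + b' + a * c') (c + c') := by
  apply Subtype.ext
  show (!![1, a, b; 0, 1, c; 0, 0, 1] * !![1, a', b'; 0, 1, c'; 0, 0, 1] : Matrix (Fin 3) (Fin 3) F) = !![_, _, _; _, _, _; _, _, _]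
  ext i j
  fin_cases i <;> fin_cases j <;> simp [Matrix.mul_apply, Fin.sum_univ_three] <;> ring

theorem gmul (g h : G3 F) (i j : Fin 3) : (g * h) i j = g i 0 * h 0 j + g i 1 * h 1 j + g i 2 * h 2 j := by
  show (g.1 * h.1) i j = _
  rw [Matrix.mul_apply, Fin.sum_univ_three]

theorem un_one : (un 0 0 0 : G3 F) = 1 := by
  ext i j
  fin_cases i <;> fin_cases j <;> simp [un]

theorem un_inv (a b c : F) : (un a b c)⁻¹ = un (-a) (a * c - b) (-c) := by
  rw [inv_eq_iff_mul_eq_one, un_mul, ← un_one]; ring_nf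

theorem un_inj {a b c a' b' c' : F} (h : un a b c = un a' b' c') : a = a' ∧ b = b' ∧ c = c' := by
  have h' := congrArg Subtype.val h
  refine ⟨congrFun (congrFun h' 0) 1, congrFun (congrFun h' 0) 2, congrFun (congrFun h' 1) 2⟩

theorem un_trace (a b c : F) : (un a b c).1.trace = 3 := by
  simp [un, Matrix.trace_fin_three]; norm_num

theorem mkun_inj (h3 : (3 : F) ≠ 0) {a b c a' b' c' : F} (h : mk3 (un a b c) = mk3 (un a' b' c')) :
    a = a' ∧ b = b' ∧ c = c' := un_inj (mk3_inj h3 (un_trace _ _ _) (un_trace _ _ _) h)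

/-- unitriangular subgroup -/
def Qs (F : Type) [Field F] : Subgroup (G3 F) where
  carrier := {g | ∃ a b c, g = un a b c}
  mul_mem' := by rintro _ _ ⟨a, b, c, rfl⟩ ⟨a', b', c', rfl⟩; exact ⟨_, _, _, un_mul _ _ _ _ _ _⟩
  one_mem' := ⟨0, 0, 0, un_one.symm⟩
  inv_mem' := by rintro _ ⟨a, b, c, rfl⟩; exact ⟨_, _, _, un_inv _ _ _⟩

theorem adj2 (g : G3 F) (i j : Fin 3) : (g⁻¹) i j = g.1.adjugate i j := by
  rw [← Matrix.SpecialLinearGroup.coe_inv]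

/-- parabolic subgroup -/
def Ps (F : Type) [Field F] : Subgroup (G3 F) where
  carrier := {g | g 2 0 = 0 ∧ g 2 1 = 0}
  mul_mem' := by
    rintro g h ⟨a, b⟩ ⟨c, d⟩
    constructor <;> simp [Matrix.mul_apply, Fin.sum_univ_three, a, b, c, d]
  one_mem' := by constructor <;> simp
  inv_mem' := by
    rintro g ⟨a, b⟩
    simp only [Set.mem_ofPred_eq, adj2, Matrix.adjugate_fin_three]
    constructor <;> simp [a, b]

/-- Borel subgroup -/
def Bs (F : Type) [Field F] : Subgroup (G3 F) where
  carrier := {g | g 1 0 = 0 ∧ g 2 0 = 0 ∧ g 2 1 = 0}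
  mul_mem' := by
    rintro g h ⟨a, b, e⟩ ⟨c, d, f⟩
    refine ⟨?_, ?_, ?_⟩ <;> simp [Matrix.mul_apply, Fin.sum_univ_three, a, b, c, d, e, f]
  one_mem' := by refine ⟨?_, ?_, ?_⟩ <;> simp
  inv_mem' := by
    rintro g ⟨a, b, e⟩
    simp only [Set.mem_ofPred_eq, adj2, Matrix.adjugate_fin_three]
    refine ⟨?_, ?_, ?_⟩ <;> simp [a, b, e]

theorem det3 (g : G3 F) : g 0 0 * g 1 1 * g 2 2 - g 0 0 * g 1 2 * g 2 1 - g 0 1 * g 1 0 * g 2 2 +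
    g 0 1 * g 1 2 * g 2 0 + g 0 2 * g 1 0 * g 2 1 - g 0 2 * g 1 1 * g 2 0 = 1 := by
  rw [← Matrix.det_fin_three]; exact g.2

theorem center_le_Bs : Subgroup.center (G3 F) ≤ Bs F := by
  intro g hg
  obtain ⟨r, -, hr⟩ := Matrix.SpecialLinearGroup.mem_center_iff.1 hg
  refine ⟨?_, ?_, ?_⟩ <;> show g.1 _ _ = 0 <;> rw [← hr] <;> simp

theorem Bs_le_Ps : Bs F ≤ Ps F := fun _ h => ⟨h.2.1, h.2.2⟩

variable [Fintype F]

theorem card_G3 : Nat.card (G3 F) * (Nat.card F - 1) =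
    (Nat.card F ^ 3 - 1) * (Nat.card F ^ 3 - Nat.card F) * (Nat.card F ^ 3 - Nat.card F ^ 2) := by
  classical
  have h := Matrix.card_GL_field (𝔽 := F) 3
  simp [Fin.prod_univ_three, ← Nat.card_eq_fintype_card] at h
  rw [← h]
  have h1 := Subgroup.card_mul_index (Matrix.GeneralLinearGroup.det (n := Fin 3) (R := F)).ker
  rw [Subgroup.index_ker, MonoidHom.range_eq_top.2] at h1
  · rw [Subgroup.card_top, Nat.card_units] at h1
    rw [← h1]
    congr 1
    have e : (Matrix.GeneralLinearGroup.det (n := Fin 3) (R := F)).ker = (Matrix.SpecialLinearGroup.toGL (n := Fin 3) (R := F)).range := by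
      ext g
      constructor
      · intro hg
        have : g.1.det = 1 := congrArg Units.val hg
        exact ⟨⟨g.1, this⟩, by ext; rfl⟩
      · rintro ⟨x, rfl⟩
        apply Units.ext
        exact x.2
    rw [e]
    refine Nat.card_congr (MonoidHom.ofInjective (f := Matrix.SpecialLinearGroup.toGL) ?_).toEquiv
    exact Matrix.SpecialLinearGroup.toGL_injective
  · intro u
    refine ⟨Matrix.GeneralLinearGroup.mkOfDetNeZero (Matrix.diagonal ![u.1, 1, 1]) ?_, ?_⟩
    · simp [Matrix.det_diagonal, Fin.prod_univ_three]
    · ext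
      simp [Matrix.GeneralLinearGroup.mkOfDetNeZero, Matrix.det_diagonal, Fin.prod_univ_three]

theorem card_Qs : Nat.card (Qs F) = Nat.card F ^ 3 := by
  have : Nat.card (Qs F) = Nat.card (F × F × F) := by
    symm
    refine Nat.card_congr (Equiv.ofBijective (fun x => (⟨un x.1 x.2.1 x.2.2, _, _, _, rfl⟩ : Qs F)) ⟨?_, ?_⟩)
    · rintro ⟨a, b, c⟩ ⟨a', b', c'⟩ h
      obtain ⟨rfl, rfl, rfl⟩ := un_inj (congrArg Subtype.val h)
      rfl
    · rintro ⟨_, a, b, c, rfl⟩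
      exact ⟨(a, b, c), rfl⟩
  rw [this, Nat.card_prod, Nat.card_prod]; ring

theorem card_Bs : Nat.card (Bs F) = Nat.card F ^ 3 * (Nat.card F - 1) ^ 2 := by
  have : Nat.card (Bs F) = Nat.card (Fˣ × Fˣ × F × F × F) := by
    symm
    refine Nat.card_congr (Equiv.ofBijective (fun x => (⟨⟨!![(x.1 : F), x.2.2.1, x.2.2.2.1; 0, x.2.1, x.2.2.2.2;
      0, 0, (x.1 : F)⁻¹ * (x.2.1 : F)⁻¹], ?_⟩, ?_⟩ : Bs F)) ⟨?_, ?_⟩)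
    · simp [Matrix.det_fin_three]
      field_simp
    · refine ⟨?_, ?_, ?_⟩ <;> simp
    · rintro ⟨a, b, c, d, e⟩ ⟨a', b', c', d', e'⟩ h
      have h1 := congrArg (fun x : Bs F => x.1.1) h
      have k1 : a.1 = a'.1 := congrFun (congrFun h1 0) 0
      have k2 : b.1 = b'.1 := congrFun (congrFun h1 1) 1
      have k3 : c = c' := congrFun (congrFun h1 0) 1
      have k4 : d = d' := congrFun (congrFun h1 0) 2
      have k5 : e = e' := congrFun (congrFun h1 1) 2
      rw [Units.ext k1, Units.ext k2, k3, k4, k5]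
    · rintro ⟨g, h1, h2, h3⟩
      have hd := det3 g
      rw [h1, h2, h3] at hd
      ring_nf at hd
      have n0 : g 0 0 ≠ 0 := by intro h; rw [h] at hd; simp at hd
      have n1 : g 1 1 ≠ 0 := by intro h; rw [h] at hd; simp at hd
      refine ⟨⟨Units.mk0 _ n0, Units.mk0 _ n1, g 0 1, g 0 2, g 1 2⟩, ?_⟩
      ext i j
      fin_cases i <;> fin_cases j <;> simp [h1, h2, h3]
      field_simp
      linear_combination -hd
  rw [this]
  simp only [Nat.card_prod, Nat.card_units]; ring

theorem card_Ps : Nat.card (Ps F) = Nat.card F ^ 2 * ((Nat.card F ^ 2 - 1) * (Nat.card F ^ 2 - Nat.card F)) := by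
  classical
  have : Nat.card (Ps F) = Nat.card ((F × F) × GL (Fin 2) F) := by
    symm
    refine Nat.card_congr (Equiv.ofBijective (fun x => (⟨⟨!![x.2.1 0 0, x.2.1 0 1, x.1.1; x.2.1 1 0, x.2.1 1 1, x.1.2;
      0, 0, (x.2.1.det)⁻¹], ?_⟩, ?_⟩ : Ps F)) ⟨?_, ?_⟩)
    · have : x.2.1.det ≠ 0 := x.2.det.ne_zero
      rw [Matrix.det_fin_two] at this
      simp [Matrix.det_fin_three, Matrix.det_fin_two]
      field_simp
    · refine ⟨?_, ?_⟩ <;> simp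
    · rintro ⟨⟨a, b⟩, g⟩ ⟨⟨a', b'⟩, g'⟩ h
      have h1 := congrArg (fun x : Ps F => x.1.1) h
      have k1 : a = a' := congrFun (congrFun h1 0) 2
      have k2 : b = b' := congrFun (congrFun h1 1) 2
      have k3 : g = g' := by
        ext i j
        fin_cases i <;> fin_cases j
        · exact congrFun (congrFun h1 0) 0
        · exact congrFun (congrFun h1 0) 1
        · exact congrFun (congrFun h1 1) 0
        · exact congrFun (congrFun h1 1) 1
      rw [k1, k2, k3]
    · rintro ⟨g, h2, h3⟩
      have hd := det3 g
      rw [h2, h3] at hd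
      have hd' : (g 0 0 * g 1 1 - g 0 1 * g 1 0) * g 2 2 = 1 := by linear_combination hd
      have n0 : (!![g 0 0, g 0 1; g 1 0, g 1 1]).det ≠ 0 := by
        rw [Matrix.det_fin_two_of]
        exact left_ne_zero_of_mul_eq_one hd'
      refine ⟨⟨⟨g 0 2, g 1 2⟩, Matrix.GeneralLinearGroup.mkOfDetNeZero _ n0⟩, ?_⟩
      rw [Matrix.det_fin_two_of] at n0
      ext i j
      fin_cases i <;> fin_cases j <;> simp [h2, h3, Matrix.GeneralLinearGroup.mkOfDetNeZero]
      exact inv_eq_of_mul_eq_one_right hd'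
  rw [this, Nat.card_prod, Nat.card_prod, Matrix.card_GL_field]
  simp [Fin.prod_univ_two]; left; ring

theorem index_Bs : (Bs F).index = (Nat.card F + 1) * (Nat.card F ^ 2 + Nat.card F + 1) := by
  have h1 := Subgroup.card_mul_index (Bs F)
  have h2 := card_G3 (F := F)
  rw [← h1, card_Bs] at h2
  obtain ⟨n, hn⟩ : ∃ n, Nat.card F = n + 2 := ⟨Nat.card F - 2, by have := Finite.one_lt_card (α := F); omega⟩
  rw [hn] at h2 ⊢
  have e1 : (n + 2) ^ 3 - 1 = (n + 1) * ((n + 2) ^ 2 + (n + 2) + 1) := by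
    apply Nat.sub_eq_of_eq_add; ring
  have e2 : (n + 2) ^ 3 - (n + 2) = (n + 2) * (n + 1) * (n + 3) := by
    apply Nat.sub_eq_of_eq_add; ring
  have e3 : (n + 2) ^ 3 - (n + 2) ^ 2 = (n + 2) ^ 2 * (n + 1) := by
    apply Nat.sub_eq_of_eq_add; ring
  rw [e1, e2, e3, show n + 2 - 1 = n + 1 by omega] at h2
  have : 0 < (n + 2) ^ 3 * (n + 1) ^ 3 := by positivity
  apply Nat.eq_of_mul_eq_mul_left this
  linarith

theorem index_Ps : (Ps F).index = (Nat.card F ^ 2 + Nat.card F + 1) := by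
  have h1 := Subgroup.card_mul_index (Ps F)
  have h2 := card_G3 (F := F)
  rw [← h1, card_Ps] at h2
  obtain ⟨n, hn⟩ : ∃ n, Nat.card F = n + 2 := ⟨Nat.card F - 2, by have := Finite.one_lt_card (α := F); omega⟩
  rw [hn] at h2 ⊢
  have e1 : (n + 2) ^ 3 - 1 = (n + 1) * ((n + 2) ^ 2 + (n + 2) + 1) := by
    apply Nat.sub_eq_of_eq_add; ring
  have e2 : (n + 2) ^ 3 - (n + 2) = (n + 2) * (n + 1) * (n + 3) := by
    apply Nat.sub_eq_of_eq_add; ring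
  have e3 : (n + 2) ^ 3 - (n + 2) ^ 2 = (n + 2) ^ 2 * (n + 1) := by
    apply Nat.sub_eq_of_eq_add; ring
  have e4 : (n + 2) ^ 2 - 1 = (n + 1) * (n + 3) := by
    apply Nat.sub_eq_of_eq_add; ring
  have e5 : (n + 2) ^ 2 - (n + 2) = (n + 2) * (n + 1) := by
    apply Nat.sub_eq_of_eq_add; ring
  rw [e1, e2, e3, e4, e5, show n + 2 - 1 = n + 1 by omega] at h2
  have : 0 < (n + 2) ^ 3 * (n + 1) ^ 3 * (n + 3) := by positivity
  apply Nat.eq_of_mul_eq_mul_left this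
  linarith

end Basics


section Syl

variable (F : Type) [Field F] [Fintype F]

/-- image of the unitriangular subgroup -/
def Qb : Subgroup (PS F) := (Qs F).map mk3

variable {F}

theorem mem_Qb {s : PS F} : s ∈ Qb F ↔ ∃ a b c, s = mk3 (un a b c) := by
  constructor
  · rintro ⟨_, ⟨a, b, c, rfl⟩, rfl⟩; exact ⟨a, b, c, rfl⟩
  · rintro ⟨a, b, c, rfl⟩; exact ⟨_, ⟨a, b, c, rfl⟩, rfl⟩

theorem mkun_mul (a b c a' b' c' : F) : mk3 (un a b c) * mk3 (un a' b' c') =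
    mk3 (un (a + a') (b + b' + a * c') (c + c')) := by
  rw [← map_mul, un_mul]

variable (h3 : (3 : F) ≠ 0)
include h3

theorem Qb_center {s : PS F} (hs : s ∈ Qb F) (hc : ∀ x ∈ Qb F, s * x = x * s) :
    ∃ t, s = mk3 (un 0 t 0) := by
  obtain ⟨a, b, c, rfl⟩ := mem_Qb.1 hs
  have h1 := hc (mk3 (un 1 0 0)) (mem_Qb.2 ⟨_, _, _, rfl⟩)
  have h2 := hc (mk3 (un 0 0 1)) (mem_Qb.2 ⟨_, _, _, rfl⟩)
  rw [mkun_mul, mkun_mul] at h1 h2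
  have k1 := (mkun_inj h3 h1).2.1
  have k2 := (mkun_inj h3 h2).2.1
  simp at k1 k2
  exact ⟨b, by rw [k1, k2]⟩

omit h3 in
theorem center_Qb (t : F) (x : PS F) (hx : x ∈ Qb F) : mk3 (un 0 t 0) * x = x * mk3 (un 0 t 0) := by
  obtain ⟨a, b, c, rfl⟩ := mem_Qb.1 hx
  rw [mkun_mul, mkun_mul]
  congr 2 <;> ring

omit h3 in
/-- stabilizer of the root group -/
def Nst (F : Type) [Field F] : Subgroup (MulAut (PS F)) where
  carrier := {φ | ∀ x, (∃ t, φ x = mk3 (un 0 t 0)) ↔ (∃ t, x = mk3 (un 0 t 0))}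
  mul_mem' := by
    intro φ χ hφ hχ x
    exact (hφ (χ x)).trans (hχ x)
  one_mem' := by intro x; rfl
  inv_mem' := by
    intro φ hφ x
    rw [← hφ]; simp

theorem Nst_of_Qb (φ : MulAut (PS F)) (h : ∀ x, φ x ∈ Qb F ↔ x ∈ Qb F) : φ ∈ Nst F := by
  intro x
  constructor
  · rintro ⟨t, ht⟩
    apply Qb_center h3
    · rw [← h, ht]; exact mem_Qb.2 ⟨_, _, _, rfl⟩
    · intro y hy
      apply φ.injective
      rw [map_mul, map_mul, ht]
      exact center_Qb t _ ((h y).2 hy)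
  · rintro ⟨t, rfl⟩
    apply Qb_center h3
    · rw [h]; exact mem_Qb.2 ⟨_, _, _, rfl⟩
    · intro y hy
      apply φ.symm.injective
      rw [map_mul, map_mul, MulEquiv.symm_apply_apply]
      apply center_Qb t
      rw [← h]; simpa using hy

variable (p : ℕ) [Fact p.Prime] [CharP F p]

omit h3 in
theorem pgroup_Qb : IsPGroup p (Qb F) := by
  obtain ⟨n, -, hn⟩ := FiniteField.card F p
  have : IsPGroup p (Qs F) := by
    rw [IsPGroup.iff_card]
    exact ⟨n * 3, by rw [card_Qs, Nat.card_eq_fintype_card, hn, pow_mul]⟩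
  exact this.map _

omit h3 in
theorem index_Qs : (Qs F).index = (Nat.card F - 1) ^ 2 * ((Nat.card F + 1) * (Nat.card F ^ 2 + Nat.card F + 1)) := by
  have h1 := Subgroup.card_mul_index (Bs F)
  have h2 := Subgroup.card_mul_index (Qs F)
  rw [card_Bs, index_Bs] at h1
  rw [card_Qs] at h2
  have : 0 < Nat.card F ^ 3 := pow_pos Nat.card_pos _
  apply Nat.eq_of_mul_eq_mul_left this
  rw [h2, ← h1]; ring

omit h3 in
theorem p_dvd_q : (p : ℤ) ∣ (Nat.card F : ℤ) := by
  obtain ⟨n, -, hn⟩ := FiniteField.card F p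
  rw [Nat.card_eq_fintype_card, hn]
  push_cast
  exact dvd_pow_self _ n.ne_zero

omit h3 in
theorem index_Qb : ¬ p ∣ (Qb F).index := by
  intro h
  have hp : p.Prime := Fact.out
  have h1 := h.trans (Subgroup.index_map_dvd (Qs F) (f := mk3) (QuotientGroup.mk'_surjective _))
  rw [index_Qs] at h1
  have hq := p_dvd_q (F := F) p
  have hpi : Prime (p : ℤ) := Nat.prime_iff_prime_int.1 hp
  have h2 : (p : ℤ) ∣ (((Nat.card F : ℤ) - 1) ^ 2 * ((Nat.card F + 1) * (Nat.card F ^ 2 + Nat.card F + 1))) := by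
    have := Int.natCast_dvd_natCast.2 h1
    rw [Nat.cast_mul, Nat.cast_pow, Nat.cast_sub Nat.card_pos] at this
    exact_mod_cast this
  have h4 : (p : ℤ) ∣ 1 := by
    rw [← Int.dvd_add_right (b := (((Nat.card F : ℤ) - 1) ^ 2 * ((Nat.card F + 1) * (Nat.card F ^ 2 + Nat.card F + 1))) - 1) ]
    · simpa using h2
    · refine hq.trans ⟨(Nat.card F : ℤ) ^ 4 -Nat.card F ^ 2 - Nat.card F , ?_⟩
      ring
  exact hpi.not_dvd_one h4

/-- the Sylow subgroup -/
noncomputable def QSyl : Sylow p (PS F) := (pgroup_Qb (F := F) p).toSylow (index_Qb p)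

omit h3 in
theorem mem_smul_Syl (φ : MulAut (PS F)) (P : Sylow p (PS F)) (x : PS F) : x ∈ φ • P ↔ φ⁻¹ x ∈ P := by
  show x ∈ ((φ • P : Sylow p (PS F)) : Subgroup (PS F)) ↔ _
  rw [Sylow.pointwise_smul_def, Subgroup.mem_pointwise_smul_iff_inv_smul_mem]
  rfl

include p
omit h3 in
theorem sylow_conj (φ : MulAut (PS F)) : ∃ s : PS F, ∀ x, (MulAut.conj s * φ) x ∈ Qb F ↔ x ∈ Qb F := by
  obtain ⟨s, hs⟩ := MulAction.exists_smul_eq (PS F) (φ • QSyl (F := F) p) (QSyl p)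
  refine ⟨s, fun x => ?_⟩
  have h : MulAut.conj s • φ • QSyl (F := F) p = QSyl p := hs
  rw [smul_smul] at h
  have := mem_smul_Syl p (MulAut.conj s * φ) (QSyl p) ((MulAut.conj s * φ) x)
  rw [h, MulAut.inv_apply_self] at this
  exact this

omit h3 in
theorem sylow_fix (φ : MulAut (PS F)) (k : ℕ) (hk : orderOf φ = p ^ k) :
    ∃ s : PS F, ∀ x, ((MulAut.conj s * φ * (MulAut.conj s)⁻¹ : MulAut (PS F)) x) ∈ Qb F ↔ x ∈ Qb F := by
  have hG : IsPGroup p (Subgroup.zpowers φ) := by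
    rw [IsPGroup.iff_card]; exact ⟨k, by rw [Nat.card_zpowers, hk]⟩
  have hne : (MulAction.fixedPoints (Subgroup.zpowers φ) (Sylow p (PS F))).Nonempty := by
    apply hG.nonempty_fixed_point_of_prime_not_dvd_card
    intro h
    have h1 := card_sylow_modEq_one p (PS F)
    have := (Nat.modEq_zero_iff_dvd.2 h).symm.trans h1
    exact (Fact.out : p.Prime).one_lt.ne' (Nat.dvd_one.1 ((Nat.modEq_iff_dvd' (by omega)).1 this))
  obtain ⟨P, hP⟩ := hne
  obtain ⟨s, hs⟩ := MulAction.exists_smul_eq (PS F) P (QSyl p)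
  have h1 : φ • P = P := hP ⟨φ, Subgroup.mem_zpowers φ⟩
  have h2 : MulAut.conj s • P = QSyl p := hs
  refine ⟨s, fun x => ?_⟩
  have h : (MulAut.conj s * φ * (MulAut.conj s)⁻¹) • QSyl (F := F) p = QSyl p := by
    rw [mul_smul, mul_smul, ← h2, inv_smul_smul, h1]
  have := mem_smul_Syl p (MulAut.conj s * φ * (MulAut.conj s)⁻¹) (QSyl p) ((MulAut.conj s * φ * (MulAut.conj s)⁻¹) x)
  rw [h, MulAut.inv_apply_self] at this
  exact this

end Syl


section ChiOneA

variable {F : Type} [Field F]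

/-- upper triangular element -/
def utm (a b c d e f : F) (h : a * d * f = 1) : G3 F := ⟨!![a, b, c; 0, d, e; 0, 0, f], by
  simp [Matrix.det_fin_three, h]⟩

theorem exists_b (m μ : Fin 3 → F) (hm : m 0 ≠ 0 ∨ m 1 ≠ 0 ∨ m 2 ≠ 0) (hμ : μ 0 ≠ 0 ∨ μ 1 ≠ 0 ∨ μ 2 ≠ 0)
    (hμm : μ 0 * m 0 + μ 1 * m 1 + μ 2 * m 2 = 0)
    (hnot : ¬ (m 1 = 0 ∧ m 2 = 0 ∧ μ 0 = 0 ∧ μ 1 = 0)) (z : F) (hz : z ≠ 0) :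
    ∃ b ∈ Bs F, ∃ x y : F, (∀ i, b i 0 * m 0 + b i 1 * m 1 + b i 2 * m 2 = x * m i) ∧
      (∀ j, μ 0 * b 0 j + μ 1 * b 1 j + μ 2 * b 2 j = y * μ j) ∧
      ∃ k : ℕ, (k = 1 ∨ k = 2 ∨ k = 3) ∧ x / y = z ^ k * (b 0 0 / b 2 2) := by
  have key : ∀ (a b c d e f : F) (h : a * d * f = 1) (x y : F) (k : ℕ), (k = 1 ∨ k = 2 ∨ k = 3) →
      a * m 0 + b * m 1 + c * m 2 = x * m 0 → d * m 1 + e * m 2 = x * m 1 → f * m 2 = x * m 2 →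
      μ 0 * a = y * μ 0 → μ 0 * b + μ 1 * d = y * μ 1 → μ 0 * c + μ 1 * e + μ 2 * f = y * μ 2 →
      x / y = z ^ k * (a / f) → ∃ b ∈ Bs F, ∃ x y : F, (∀ i, b i 0 * m 0 + b i 1 * m 1 + b i 2 * m 2 = x * m i) ∧
      (∀ j, μ 0 * b 0 j + μ 1 * b 1 j + μ 2 * b 2 j = y * μ j) ∧
      ∃ k : ℕ, (k = 1 ∨ k = 2 ∨ k = 3) ∧ x / y = z ^ k * (b 0 0 / b 2 2) := by
    intro a b c d e f h x y k hk h1 h2 h3 h4 h5 h6 h7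
    refine ⟨utm a b c d e f h, ⟨rfl, rfl, rfl⟩, x, y, ?_, ?_, k, hk, h7⟩
    · intro i
      fin_cases i <;> simp [utm, h1, h2, h3]
    · intro i
      fin_cases i <;> simp [utm, h4, h5, h6]
  by_cases m2 : m 2 = 0
  · by_cases m1 : m 1 = 0
    · have m0 : m 0 ≠ 0 := by tauto
      have μ0 : μ 0 = 0 := by simpa [m1, m2, m0] using hμm
      have μ1 : μ 1 ≠ 0 := by tauto
      refine key z 0 0 z⁻¹ ((z⁻¹ - 1) * μ 2 / μ 1) 1 (by field_simp) z z⁻¹ 1 (by simp) ?_ ?_ ?_ ?_ ?_ ?_ ?_ <;>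
      simp [m1, m2, μ0] <;> field_simp
      ring
    · by_cases μ0 : μ 0 = 0
      · have μ1 : μ 1 = 0 := by simpa [m1, m2, μ0] using hμm
        refine key 1 ((z - 1) * m 0 / m 1) 0 z 0 z⁻¹ (by field_simp) z z⁻¹ 1 (by simp) ?_ ?_ ?_ ?_ ?_ ?_ ?_ <;>
        simp [m1, m2, μ0, μ1] <;> field_simp
        ring
      · have hr : μ 1 = - (μ 0 * m 0) / m 1 := by field_simp; rw [m2] at hμm; linear_combination hμm
        refine key z⁻¹ ((z - 1) * m 0 / m 1 + (z⁻¹ - 1) * μ 1 / μ 0) ((z⁻¹ - 1) * μ 2 / μ 0) z 0 1 (by field_simp) z z⁻¹ 3 (by simp) ?_ ?_ ?_ ?_ ?_ ?_ ?_ <;>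
        (try simp [m2, hr]) <;> field_simp <;> ring
  · by_cases μ0 : μ 0 = 0
    · have μ1 : μ 1 ≠ 0 := by
        intro h; rw [h, μ0] at hμm
        have : μ 2 = 0 := by simpa [m2] using hμm
        tauto
      have hr : m 1 = - (μ 2 * m 2) / μ 1 := by field_simp; rw [μ0] at hμm; linear_combination hμm
      refine key 1 0 ((z - 1) * m 0 / m 2) z⁻¹ ((z - 1) * m 1 / m 2 + (z⁻¹ - 1) * μ 2 / μ 1) z (by field_simp) z z⁻¹ 3 (by simp) ?_ ?_ ?_ ?_ ?_ ?_ ?_ <;>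
      simp [μ0, hr] <;> field_simp <;> ring
    · have hr : m 0 = - (μ 1 * m 1 + μ 2 * m 2) / μ 0 := by field_simp; linear_combination hμm
      refine key 1 ((1 - z⁻¹) * μ 1 / μ 0) ((z - z⁻¹) * m 0 / m 2 + (1 - z⁻¹) * μ 2 / μ 0) z⁻¹
        ((z - z⁻¹) * m 1 / m 2) z (by field_simp) z 1 2 (by simp) ?_ ?_ ?_ ?_ ?_ ?_ ?_ <;>
      (try simp [hr]) <;> field_simp <;> ring

theorem nonB (g : G3 F) (hg : g ∉ Bs F) (z : F) (hz : z ≠ 0) :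
    ∃ b ∈ Bs F, ∃ b' ∈ Bs F, g * b = b' * g ∧ 
      ∃ k : ℕ, (k = 1 ∨ k = 2 ∨ k = 3) ∧ b' 0 0 / b' 2 2 = z ^ k * (b 0 0 / b 2 2) := by
  have hl : ∀ i j, (g⁻¹ * g) i j = (1 : G3 F) i j := by intro i j; rw [inv_mul_cancel]
  have hr : ∀ i j, (g * g⁻¹) i j = (1 : G3 F) i j := by intro i j; rw [mul_inv_cancel]
  simp only [gmul] at hl hr
  obtain ⟨b, hb, x, y, h1, h2, k, hk, h4⟩ := exists_b (fun i => g⁻¹ i 0) (fun j => g 2 j) (by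
      by_contra! h
      obtain ⟨a, b, c⟩ := h
      have := hr 0 0
      rw [a, b, c] at this; simp at this) (by
      by_contra! h
      obtain ⟨a, b, c⟩ := h
      have := hr 2 2
      rw [a, b, c] at this; simp at this) (by
      have := hr 2 0
      simpa using this) (by
      rintro ⟨a, b, c, d⟩
      apply hg
      refine ⟨?_, c, d⟩
      have k1 := hr 0 0
      have k2 := hr 1 0
      have k3 := hr 2 0
      rw [a, b] at k1 k2 k3
      simp at k1 k2 k3
      rcases k2 with h | h
      · exact h
      · rw [h] at k1; simp at k1) z hz
  refine ⟨b, hb, g * b * g⁻¹, ?_, by group, k, hk, ?_⟩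
  · have c0 : ∀ i, (g * b * g⁻¹) i 0 = x * (1 : G3 F) i 0 := by
      intro i
      rw [mul_assoc, gmul, gmul, gmul, gmul, h1, h1, h1, ← hr]; ring
    have c2 : ∀ j, (g * b * g⁻¹) 2 j = y * (1 : G3 F) 2 j := by
      intro j
      rw [gmul, gmul, gmul, gmul, h2, h2, h2, ← hr]; ring
    refine ⟨?_, ?_, ?_⟩
    · rw [c0]; simp
    · rw [c0]; simp
    · rw [c2]; simp
  · have c0 : ∀ i, (g * b * g⁻¹) i 0 = x * (1 : G3 F) i 0 := by
      intro i
      rw [mul_assoc, gmul, gmul, gmul, gmul, h1, h1, h1, ← hr]; ring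
    have c2 : ∀ j, (g * b * g⁻¹) 2 j = y * (1 : G3 F) 2 j := by
      intro j
      rw [gmul, gmul, gmul, gmul, h2, h2, h2, ← hr]; ring
    rw [c0, c2, ← h4]; simp

theorem B_diag {b : G3 F} (hb : b ∈ Bs F) : b 0 0 ≠ 0 ∧ b 1 1 ≠ 0 ∧ b 2 2 ≠ 0 := by
  have h := det3 b
  obtain ⟨h1, h2, h3⟩ := hb
  rw [h1, h2, h3] at h
  refine ⟨?_, ?_, ?_⟩ <;> intro h0 <;> rw [h0] at h <;> simp at h

theorem conj_zb {b : G3 F} (hb : b ∈ Bs F) (t : F) :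
    MulAut.conj (mk3 b) (mk3 (un 0 t 0)) = mk3 (un 0 (b 0 0 / b 2 2 * t) 0) := by
  rw [MulAut.conj_apply, mul_inv_eq_iff_eq_mul, ← map_mul, ← map_mul]
  congr 1
  ext i j
  have := (B_diag hb).2.2
  obtain ⟨h1, h2, h3⟩ := hb
  show (b * un 0 t 0) i j = (un 0 (b 0 0 / b 2 2 * t) 0 * b) i j
  rw [gmul, gmul]
  fin_cases i <;> fin_cases j <;> simp [un, h1, h2, h3] <;> field_simp
  ring

theorem conj_mem_Nst {b : G3 F} (hb : b ∈ Bs F) : MulAut.conj (mk3 b) ∈ Nst F := by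
  intro x
  constructor
  · rintro ⟨t, ht⟩
    have := conj_zb ((Bs F).inv_mem hb) t
    rw [← ht, map_inv, map_inv, MulAut.inv_apply_self] at this
    exact ⟨_, this⟩
  · rintro ⟨t, rfl⟩
    exact ⟨_, conj_zb hb t⟩

theorem Bs_of_conj (h3 : (3 : F) ≠ 0) {g : G3 F} (hg : MulAut.conj (mk3 g) ∈ Nst F) : g ∈ Bs F := by
  obtain ⟨t, ht⟩ := (hg (mk3 (un 0 1 0))).2 ⟨1, rfl⟩
  rw [MulAut.conj_apply, ← map_inv, ← map_mul, ← map_mul] at ht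
  have h1 := mk3_inj h3 (by
    show (g.1 * (un 0 1 0).1 * (g⁻¹).1).trace = 3
    rw [Matrix.trace_mul_cycle, ← Matrix.SpecialLinearGroup.coe_mul]
    simp [un_trace]) (un_trace _ _ _) ht
  rw [mul_inv_eq_iff_eq_mul] at h1
  have h2 : ∀ i j, (g * un 0 1 0 : G3 F) i j = (un 0 t 0 * g : G3 F) i j := by intro i j; rw [h1]
  simp only [gmul] at h2
  have a1 := h2 1 2
  have a2 := h2 2 2
  have a3 := h2 0 1
  have a4 := h2 0 2
  simp [un] at a1 a2 a3 a4
  refine ⟨a1, a2, ?_⟩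
  rcases a3 with h | h
  · have := det3 g
    have a5 : g 0 0 = t * g 2 2 := by linear_combination a4
    rw [a1, a2, a5, h] at this
    simp at this
  · exact h

end ChiOneA


theorem exists_theta (p : ℕ) [Fact p.Prime] (hp5 : 5 ≤ p) : ∃ (θ : MulChar (ZMod p) ℂ) (u : ZMod p),
    u ≠ 0 ∧ ∀ k : ℕ, (k = 1 ∨ k = 2 ∨ k = 3) → θ u ^ k ≠ 1 := by
  obtain ⟨θ, hθ⟩ := MulChar.exists_mulChar_orderOf (ZMod p) (R := ℂ) (n := p - 1) (by rw [ZMod.card])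
    (Complex.isPrimitiveRoot_exp (p - 1) (by omega))
  obtain ⟨u, hu⟩ := IsCyclic.exists_generator (α := (ZMod p)ˣ)
  refine ⟨θ, u, u.ne_zero, fun k hk h => ?_⟩
  have : θ ^ k = 1 := by
    ext x
    obtain ⟨j, hj⟩ := Subgroup.mem_zpowers_iff.1 (hu x)
    have hinv : ∀ j : ℤ, θ ((u ^ j : (ZMod p)ˣ) : ZMod p) ^ k = 1 := by
      intro j
      have h1 : ((θ.toUnitHom u) ^ k) = 1 := by
        ext; simpa using h
      have h2 : ((θ.toUnitHom (u ^ j)) ^ k) = 1 := by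
        rw [map_zpow, ← zpow_natCast, zpow_comm, zpow_natCast, h1, one_zpow]
      have h4 := congrArg Units.val h2
      rw [Units.val_pow_eq_pow_val, MulChar.coe_toUnitHom] at h4
      exact h4
    rw [MulChar.pow_apply_coe, MulChar.one_apply_coe, ← hj, hinv]
  have := orderOf_dvd_of_pow_eq_one this
  rw [hθ] at this
  have := Nat.le_of_dvd (by omega) this
  omega

section ChiOne

variable {F : Type} [Field F] [Fintype F] (h3 : (3 : F) ≠ 0)
variable (p : ℕ) [Fact p.Prime] [Algebra (ZMod p) F]

theorem Lexi (n : Nst F) (t : F) : ∃ t', n.1 (mk3 (un 0 t 0)) = mk3 (un 0 t' 0) :=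
  (n.2 (mk3 (un 0 t 0))).2 ⟨t, rfl⟩

/-- the action on the root group -/
noncomputable def Lfun (n : Nst F) (t : F) : F := (Lexi n t).choose

theorem Lfun_spec (n : Nst F) (t : F) : n.1 (mk3 (un 0 t 0)) = mk3 (un 0 (Lfun n t) 0) := (Lexi n t).choose_spec

include h3 in
theorem Lfun_uniq (n : Nst F) (t t' : F) (h : n.1 (mk3 (un 0 t 0)) = mk3 (un 0 t' 0)) : Lfun n t = t' := by
  rw [Lfun_spec] at h
  exact (mkun_inj h3 h).2.1

/-- the action on the root group as homomorphism -/
noncomputable def Lhom : Nst F →* Module.End (ZMod p) F where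
  toFun n := AddMonoidHom.toZModLinearMap p (AddMonoidHom.mk' (Lfun n) (fun s t => by
    apply Lfun_uniq h3
    have : mk3 (un 0 (s + t) 0) = mk3 (un 0 s 0) * mk3 (un 0 t 0) := by rw [mkun_mul]; simp
    rw [this, map_mul, Lfun_spec, Lfun_spec, mkun_mul]; simp))
  map_one' := by
    ext t
    exact Lfun_uniq h3 1 t t rfl
  map_mul' m n := by
    ext t
    exact Lfun_uniq h3 (m * n) t (Lfun m (Lfun n t)) (by show m.1 (n.1 _) = _; rw [Lfun_spec, Lfun_spec])

/-- the linear character -/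
noncomputable def lam (θ : MulChar (ZMod p) ℂ) : Nst F →* ℂ :=
  θ.toMonoidHom.comp (LinearMap.det.comp (Lhom h3 p))

theorem lam_conj (θ : MulChar (ZMod p) ℂ) {b : G3 F} (hb : b ∈ Bs F) :
    lam h3 p θ ⟨_, conj_mem_Nst hb⟩ = θ (Algebra.norm (ZMod p) (b 0 0 / b 2 2)) := by
  show θ (LinearMap.det (Lhom h3 p ⟨_, conj_mem_Nst hb⟩)) = _
  congr 1
  rw [Algebra.norm_apply]
  congr 1
  ext t
  show Lfun ⟨_, conj_mem_Nst hb⟩ t = b 0 0 / b 2 2 * t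
  exact Lfun_uniq h3 ⟨_, conj_mem_Nst hb⟩ t _ (conj_zb hb t)

/-- scalar representation -/
noncomputable def tau1 (θ : MulChar (ZMod p) ℂ) : Representation ℂ (Nst F) ℂ :=
  (algebraMap ℂ (Module.End ℂ ℂ)).toMonoidHom.comp (lam h3 p θ)

theorem tau1_apply (θ : MulChar (ZMod p) ℂ) (n : Nst F) (v : ℂ) : tau1 h3 p θ n v = lam h3 p θ n * v := rfl

include h3

theorem decompA [CharP F p] (a : MulAut (PS F)) : ∃ (n : Nst F) (g : G3 F), a = n.1 * MulAut.conj (mk3 g) := by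
  have h3' := h3
  obtain ⟨s, hs⟩ := sylow_conj p a⁻¹
  have hn := Nst_of_Qb h3' _ hs
  obtain ⟨g, rfl⟩ := mk3_surj s
  refine ⟨⟨_, (Nst F).inv_mem hn⟩, g, ?_⟩
  simp

theorem index_Nst [CharP F p] : (Nst F).index = (Bs F).index := by
  have e : ((Nst F).comap (MulAut.conj.comp mk3)) = Bs F := by
    ext g
    exact ⟨fun h => Bs_of_conj h3 h, fun h => conj_mem_Nst h⟩
  rw [← e]
  symm
  let f := MulAut.conj.comp (mk3 (F := F))
  let k : (G3 F ⧸ (Nst F).comap f) → (MulAut (PS F) ⧸ Nst F) := fun x => Quotient.liftOn' x (fun g => (QuotientGroup.mk (f g) : MulAut (PS F) ⧸ Nst F)) (by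
    intro a b h
    rw [QuotientGroup.leftRel_apply] at h
    apply QuotientGroup.eq.2
    rw [← map_inv, ← map_mul]; exact h)
  apply Nat.card_congr (Equiv.ofBijective k ⟨?_, ?_⟩)
  · intro x y
    induction x using QuotientGroup.induction_on
    induction y using QuotientGroup.induction_on
    intro h
    apply QuotientGroup.eq.2
    have := QuotientGroup.eq.1 h
    rw [← map_inv, ← map_mul] at this
    exact this
  · intro y
    induction y using QuotientGroup.induction_on with
    | H a =>
      obtain ⟨n, g, h⟩ := decompA h3 p a⁻¹
      refine ⟨QuotientGroup.mk g⁻¹, ?_⟩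
      apply QuotientGroup.eq.2
      have : a = (f g)⁻¹ * n.1⁻¹ := by
        rw [← inv_inv a, h, mul_inv_rev]; rfl
      rw [this, map_inv, inv_inv, mul_inv_cancel_left]
      exact (Nst F).inv_mem n.2

theorem chi1 [CharP F p] (hp5 : 5 ≤ p) : ∃ (χ : FDRep ℂ (PS F)) (A : FDRep ℂ (MulAut (PS F))), Simple χ ∧
    Module.finrank ℂ χ = (Nat.card F + 1) * (Nat.card F ^ 2 + Nat.card F + 1) ∧
    ∀ s, A.character (MulAut.conj s) = χ.character s := by
  classical
  obtain ⟨θ, u, hu, hθ⟩ := exists_theta p hp5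
  obtain ⟨ζ, hζ⟩ := FiniteField.norm_surjective (ZMod p) F u
  have hζ0 : ζ ≠ 0 := by rintro rfl; simp at hζ; exact hu hζ.symm
  let V := Representation.coindV (Nst F).subtype (tau1 h3 p θ)
  let R : Representation ℂ (MulAut (PS F)) V := Representation.coind (Nst F).subtype (tau1 h3 p θ)
  have Rap : ∀ a (f : V) x, (R a f).1 x = f.1 (x * a) := fun a f x => rfl
  have fap : ∀ (f : V) (n : Nst F) x, f.1 (n.1 * x) = lam h3 p θ n * f.1 x := fun f n x => f.2 n x
  let R' : Representation ℂ (PS F) V := R.comp MulAut.conj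
  have R'ap : ∀ s (f : V) x, (R' s f).1 x = f.1 (x * MulAut.conj s) := fun a f x => rfl
  have : Module.Finite ℂ V := inferInstance
  let c : Bs F →* Nst F := (MulAut.conj.comp (mk3.comp (Bs F).subtype)).codRestrict (Nst F) (fun b => conj_mem_Nst b.2)
  let Ψ : Bs F →* ℂˣ := ((lam h3 p θ).comp c).toHomUnits
  have hΨ : ∀ b : Bs F, (Ψ b : ℂ) = θ (Algebra.norm (ZMod p) (b.1 0 0 / b.1 2 2)) := by
    intro b
    exact lam_conj h3 p θ b.2
  let ev : V →ₗ[ℂ] ℂ := { toFun := fun f => f.1 1, map_add' := fun _ _ => rfl, map_smul' := fun _ _ => rfl }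
  have hdim : Module.finrank ℂ V = (Nat.card F + 1) * (Nat.card F ^ 2 + Nat.card F + 1) := by
    rw [coind_finrank _ _ ⊤, Subgroup.range_subtype, index_Nst h3 p, index_Bs, finrank_top, Module.finrank_self, mul_one]
    intro w
    simp only [Submodule.mem_top, true_iff]
    intro h hh
    have : h = 1 := Subtype.ext hh
    rw [this, map_one]; rfl
  refine ⟨FDRep.of R', FDRep.of R, ?_, ?_, ?_⟩
  · refine irr_of_ev R' (mk3.comp (Bs F).subtype) Ψ ev ?_ ?_ ?_ ?_
    · intro v hv h1
      have h1' : v.1 1 = 0 := h1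
      have hv' : ∀ (b : Bs F) x, v.1 (x * MulAut.conj (mk3 b.1)) = Ψ b * v.1 x := by
        intro b x
        have := congrArg (fun f : V => f.1 x) (hv b)
        exact this
      have hz : ∀ g, v.1 (MulAut.conj (mk3 g)) = 0 := by
        intro g
        by_cases hg : g ∈ Bs F
        · have := hv' ⟨g, hg⟩ 1
          rw [one_mul, h1', mul_zero] at this
          exact this
        · obtain ⟨b, hb, b', hb', e, k, hk, hq⟩ := nonB g hg ζ hζ0
          have e1 := hv' ⟨b, hb⟩ (MulAut.conj (mk3 g))
          rw [← map_mul, ← map_mul, e, map_mul, map_mul, fap v ⟨_, conj_mem_Nst hb'⟩, lam_conj h3 p θ hb', hq,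
            map_mul, map_pow, hζ, map_mul, map_pow, hΨ, mul_assoc, mul_left_comm] at e1
          have e2 : (θ u ^ k - 1) * (θ (Algebra.norm (ZMod p) (b 0 0 / b 2 2)) * v.1 (MulAut.conj (mk3 g))) = 0 := by
            linear_combination e1
          rcases mul_eq_zero.1 e2 with h | h
          · exact absurd (sub_eq_zero.1 h) (hθ k hk)
          · rcases mul_eq_zero.1 h with h | h
            · have := (Ψ ⟨b, hb⟩).ne_zero
              rw [hΨ] at this
              exact absurd h this
            · exact h
      ext a
      obtain ⟨n, g, rfl⟩ := decompA h3 p a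
      rw [fap, hz, mul_zero]; rfl
    · intro v hv
      by_contra! h
      apply hv
      ext a
      obtain ⟨n, g, rfl⟩ := decompA h3 p a
      have : v.1 (1 * MulAut.conj (mk3 g)) = 0 := h (mk3 g)
      rw [one_mul] at this
      rw [fap, this, mul_zero]; rfl
    · intro b v
      show v.1 (1 * (c b).1) = _
      rw [one_mul, ← mul_one (c b).1, fap]; rfl
    · apply Module.nontrivial_of_finrank_pos (R := ℂ)
      rw [hdim]; positivity
  · exact hdim
  · intro s
    rfl

end ChiOne


section ChiTwo

variable {F : Type} [Field F]

/-- the Levi quotient -/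
def rho (g : G3 F) : Matrix (Fin 2) (Fin 2) F :=
  !![g 0 0 / g 2 2, g 0 1 / g 2 2; g 1 0 / g 2 2, g 1 1 / g 2 2]

theorem rho_mul {g h : G3 F} (hg : g ∈ Ps F) (hh : h ∈ Ps F) : rho (g * h) = rho g * rho h := by
  obtain ⟨a, b⟩ := hg
  obtain ⟨c, d⟩ := hh
  ext i j
  fin_cases i <;> fin_cases j <;>
    simp [rho, gmul, a, b, c, d, Matrix.mul_apply, Fin.sum_univ_two, -Matrix.SpecialLinearGroup.coe_mul] <;> ring

theorem rho_one : rho (1 : G3 F) = 1 := by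
  ext i j
  fin_cases i <;> fin_cases j <;> simp [rho]

theorem P22 {g : G3 F} (hg : g ∈ Ps F) : g 2 2 ≠ 0 := by
  intro h
  have := det3 g
  rw [h, hg.1, hg.2] at this
  simp at this

theorem rho_det {g : G3 F} (hg : g ∈ Ps F) : (rho g).det * g 2 2 ^ 3 = 1 := by
  have h := P22 hg
  have := det3 g
  rw [hg.1, hg.2] at this
  rw [Matrix.det_fin_two]
  simp [rho]
  field_simp
  linear_combination this

theorem rho_det_ne {g : G3 F} (hg : g ∈ Ps F) : (rho g).det ≠ 0 := by
  intro h
  have := rho_det hg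
  rw [h] at this; simp at this

variable [Fintype F] [DecidableEq F] (E : Type) [Field E] [Fintype E] [Algebra F E]

/-- the covering group of the parabolic -/
noncomputable def HH (F : Type) [Field F] (E : Type) [Field E] [Algebra F E] : Subgroup (G3 F × Eˣ) where
  carrier := {x | x.1 ∈ Ps F ∧ (rho x.1).det = Algebra.norm F (x.2 : E)}
  mul_mem' := by
    rintro x y ⟨a, b⟩ ⟨c, d⟩
    refine ⟨(Ps F).mul_mem a c, ?_⟩
    show (rho (x.1 * y.1)).det = Algebra.norm F ((x.2 * y.2 : Eˣ) : E)
    rw [rho_mul a c, Matrix.det_mul, b, d, Units.val_mul, map_mul]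
  one_mem' := by
    refine ⟨(Ps F).one_mem, ?_⟩
    show (rho 1).det = Algebra.norm F ((1 : Eˣ) : E)
    rw [rho_one]; simp
  inv_mem' := by
    rintro x ⟨a, b⟩
    refine ⟨(Ps F).inv_mem a, ?_⟩
    show (rho x.1⁻¹).det = Algebra.norm F ((x.2⁻¹ : Eˣ) : E)
    have h1 : (rho x.1).det * (rho x.1⁻¹).det = 1 := by
      rw [← Matrix.det_mul, ← rho_mul a ((Ps F).inv_mem a), mul_inv_cancel, rho_one, Matrix.det_one]
    have h2 : Algebra.norm F (x.2 : E) * Algebra.norm F ((x.2⁻¹ : Eˣ) : E) = 1 := by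
      rw [← map_mul, ← Units.val_mul, mul_inv_cancel]; simp
    rw [b] at h1
    exact (eq_inv_of_mul_eq_one_right h1).trans (eq_inv_of_mul_eq_one_right h2).symm

/-- map to the simple group -/
noncomputable def m2 : HH F E →* PS F := mk3.comp ((MonoidHom.fst _ _).comp (HH F E).subtype)

variable {E}

theorem m2_apply (h : HH F E) : m2 E h = mk3 h.1.1 := rfl

theorem wr_one (ψ : AddChar F ℂ) : wr ψ 1 (1 : E) = LinearMap.id := by
  ext f z
  rw [wr_zero ψ 1 1 (b := 0) (d := 1) (by simp) (by simp) (by simp)]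
  simp

variable (h2 : Module.finrank F E = 2) {ψ : AddChar F ℂ} (hψ : ψ ≠ 1) (ν : MulChar E ℂ)

/-- the representation of the covering group -/
noncomputable def tau2 : Representation ℂ (HH F E) (E → ℂ) where
  toFun x := ν (x.1.2 : E) • wr ψ (rho x.1.1) (x.1.2 : E)
  map_one' := by
    show ν ((1 : Eˣ) : E) • wr ψ (rho 1) ((1 : Eˣ) : E) = 1
    rw [rho_one, Units.val_one, wr_one]; simp; rfl
  map_mul' x y := by
    show ν ((x.1.2 * y.1.2 : Eˣ) : E) • wr ψ (rho (x.1.1 * y.1.1)) ((x.1.2 * y.1.2 : Eˣ) : E) = _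
    apply LinearMap.ext; intro f
    rw [rho_mul x.2.1 y.2.1, Units.val_mul, map_mul, LinearMap.smul_apply,
      wr_mul h2 ψ hψ _ _ _ _ x.2.2 y.2.2 (Units.ne_zero _) (Units.ne_zero _), Module.End.mul_apply,
      LinearMap.smul_apply, LinearMap.smul_apply, map_smul, smul_smul]

theorem tau2_apply (x : HH F E) (f : E → ℂ) : tau2 h2 hψ ν x f = ν (x.1.2 : E) • wr ψ (rho x.1.1) (x.1.2 : E) f := rfl

/-- the relevant subspace -/
def W2 (F : Type) {E : Type} [Field F] [Field E] [Algebra F E] (ν : MulChar E ℂ) : Submodule ℂ (E → ℂ) where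
  carrier := {f | ∀ e : E, Algebra.norm F e = 1 → ∀ z, ν e * f (z * e) = f z}
  add_mem' := by
    intro f g hf hg e he z
    show ν e * (f _ + g _) = f z + g z
    rw [mul_add, hf e he, hg e he]
  zero_mem' := by intro e he z; simp
  smul_mem' := by
    intro c f hf e he z
    show ν e * (c * f _) = c * f z
    rw [← hf e he z]; ring

include h2

theorem norm_neg1 : Algebra.norm F (-1 : E) = 1 := by
  have : (-1 : E) = algebraMap F E (-1) := by simp
  rw [this, Algebra.norm_algebraMap, h2]; simp

theorem W2_zero (hν : ν (-1) = -1) {f : E → ℂ} (hf : f ∈ W2 F ν) : f 0 = 0 := by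
  have := hf (-1) (norm_neg1 h2) 0
  rw [hν, zero_mul] at this
  linear_combination (-1/2 : ℂ) * this

theorem norm_ne {z : E} (hz : z ≠ 0) : Algebra.norm F z ≠ 0 := by
  have : Module.Finite F E := Module.finite_of_finrank_pos (by omega)
  simpa [Algebra.norm_eq_zero_iff] using hz

theorem W2_finrank (hν : ν (-1) = -1) : Module.finrank ℂ (W2 F ν) = Nat.card F - 1 := by
  have : Module.Finite F E := Module.finite_of_finrank_pos (by omega)
  have hsec : ∀ x : Fˣ, ∃ z : E, Algebra.norm F z = x := fun x => FiniteField.norm_surjective F E x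
  choose sec hs using hsec
  have sne : ∀ x, sec x ≠ 0 := by
    intro x h
    have := hs x
    rw [h, Algebra.norm_zero] at this
    exact x.ne_zero this.symm
  let T : W2 F ν →ₗ[ℂ] (Fˣ → ℂ) := { toFun := fun f x => f.1 (sec x), map_add' := fun _ _ => rfl, map_smul' := fun _ _ => rfl }
  have hdec : ∀ z : E, ∀ hz : z ≠ 0, ∀ x : Fˣ, Algebra.norm F z = x → Algebra.norm F (z / sec x) = 1 := by
    intro z hz x hx
    have h1 : Algebra.norm F (z / sec x) * Algebra.norm F (sec x) = Algebra.norm F z := by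
      rw [← map_mul, div_mul_cancel₀ _ (sne x)]
    rw [hs, hx] at h1
    exact (mul_eq_right₀ x.ne_zero).1 h1
  have nne : ∀ e : E, e ≠ 0 → ν e ≠ 0 := by
    intro e he
    exact ((Ne.isUnit he).map ν).ne_zero
  have hb : Function.Bijective T := by
    constructor
    · rw [injective_iff_map_eq_zero]
      intro f hf
      ext z
      show f.1 z = 0
      by_cases hz : z = 0
      · rw [hz]; exact W2_zero h2 ν hν f.2
      · let x : Fˣ := Units.mk0 _ (norm_ne h2 hz)
        have h1 := f.2 _ (hdec z hz x rfl) (sec x)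
        rw [mul_div_cancel₀ _ (sne x)] at h1
        have h3 : f.1 (sec x) = 0 := congrFun hf x
        rw [h3] at h1
        exact (mul_eq_zero.1 h1).resolve_left (nne _ (div_ne_zero hz (sne x)))
    · intro h
      classical
      refine ⟨⟨fun z => if hz : z = 0 then 0 else (ν (z / sec (Units.mk0 _ (norm_ne h2 hz))))⁻¹ * h (Units.mk0 _ (norm_ne h2 hz)), ?_⟩, ?_⟩
      · intro e he z
        have e0 : e ≠ 0 := by
          rintro rfl; rw [Algebra.norm_zero] at he; exact zero_ne_one he
        by_cases hz : z = 0
        · simp [hz]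
        · have hze : z * e ≠ 0 := mul_ne_zero hz e0
          have hx : Units.mk0 _ (norm_ne (F := F) h2 hze) = Units.mk0 _ (norm_ne h2 hz) := by
            ext; simp [he]
          simp only [dif_neg hz, dif_neg hze, hx]
          rw [mul_comm z e, mul_div_assoc, map_mul, mul_inv, ← mul_assoc, mul_inv_cancel_left₀ (nne e e0)]
      · ext x
        show (if hz : sec x = 0 then (0:ℂ) else _) = h x
        rw [dif_neg (sne x)]
        have hx : Units.mk0 _ (norm_ne (F := F) h2 (sne x)) = x := by
          ext; simp [hs]
        rw [hx, div_self (sne x)]; simp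
  rw [(LinearEquiv.ofBijective T hb).finrank_eq, Module.finrank_pi, ← Nat.card_eq_fintype_card, Nat.card_units]

end ChiTwo


section ChiTwoB

variable {F : Type} [Field F] [Fintype F] [DecidableEq F] {E : Type} [Field E] [Fintype E] [Algebra F E]
variable (h2 : Module.finrank F E = 2) {ψ : AddChar F ℂ} (hψ : ψ ≠ 1) (ν : MulChar E ℂ)

theorem W2_iff (w : E → ℂ) : w ∈ W2 F ν ↔ ∀ h, m2 E h = 1 → tau2 h2 hψ ν h w = w := by
  constructor
  · rintro hw ⟨⟨g, t⟩, hg, ht⟩ hm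
    have hr : rho g = 1 := by
      have h1 : mk3 (1 : G3 F) = mk3 g := by rw [map_one]; exact hm.symm
      obtain ⟨r, hr, hh⟩ := mk3_eq.1 h1
      have r0 : r ≠ 0 := by rintro rfl; simp at hr
      ext i j
      fin_cases i <;> fin_cases j <;> simp [rho, hh, r0]
    simp only [hr, Matrix.det_one] at ht
    rw [tau2_apply]
    simp only [hr]
    ext z
    rw [Pi.smul_apply, wr_zero ψ 1 (t : E) (b := 0) (d := 1) (by simp) (by simp) (by simp)]
    have := hw (t : E) ht.symm z
    simpa using this
  · intro hw e he z
    have e0 : e ≠ 0 := by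
      rintro rfl; 
      have : Module.Finite F E := Module.finite_of_finrank_pos (by omega)
      rw [Algebra.norm_zero] at he; exact zero_ne_one he
    have := congrFun (hw ⟨(1, Units.mk0 e e0), (Ps F).one_mem, by
      show (rho 1).det = _
      rw [rho_one]; simpa using he.symm⟩ (by rw [m2_apply]; exact map_one _)) z
    rw [tau2_apply] at this
    simp only [rho_one] at this
    rw [Pi.smul_apply, wr_zero ψ 1 _ (b := 0) (d := 1) (by simp) (by simp) (by simp)] at this
    simpa using this

include h2

theorem m2_range : (m2 E).range = (Ps F).map mk3 := by
  have : Module.Finite F E := Module.finite_of_finrank_pos (by omega)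
  ext s
  constructor
  · rintro ⟨h, rfl⟩
    exact ⟨h.1.1, h.2.1, rfl⟩
  · rintro ⟨g, hg, rfl⟩
    obtain ⟨t, ht⟩ := FiniteField.norm_surjective F E (rho g).det
    have t0 : t ≠ 0 := by
      rintro rfl; rw [Algebra.norm_zero] at ht; exact rho_det_ne hg ht.symm
    exact ⟨⟨(g, Units.mk0 t t0), hg, ht.symm⟩, rfl⟩

theorem chi2_finrank (hν : ν (-1) = -1) : Module.finrank ℂ (Representation.coindV (m2 E) (tau2 h2 hψ ν)) =
    (Nat.card F - 1) * (Nat.card F ^ 2 + Nat.card F + 1) := by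
  rw [coind_finrank (m2 E) _ (W2 F ν) (W2_iff h2 hψ ν), W2_finrank h2 ν hν, m2_range h2,
    Subgroup.index_map_eq _ (QuotientGroup.mk'_surjective _), index_Ps, mul_comm]
  rw [QuotientGroup.ker_mk']
  exact center_le_Bs.trans Bs_le_Ps

/-- wr with unimodular matrices -/
theorem wr_cancel (x y : Matrix (Fin 2) (Fin 2) F) (hx : x.det = 1) (hy : y.det = 1) (h : x * y = 1) (hψ : ψ ≠ 1) (f : E → ℂ) :
    wr ψ x (1 : E) (wr ψ y 1 f) = f := by
  rw [← wr_mul h2 ψ hψ x y 1 1 (by simpa using hx) (by simpa using hy) one_ne_zero one_ne_zero, h, mul_one, wr_one]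
  rfl

theorem fixed_zero (hψ : ψ ≠ 1) (y0 y1 : F) (hy : y0 ≠ 0 ∨ y1 ≠ 0) (f : E → ℂ) (hodd : wr ψ 1 (-1 : E) f = - f)
    (hf : ∀ s : F, wr ψ !![1 + s * y0 * y1, - s * y0 ^ 2; s * y1 ^ 2, 1 - s * y0 * y1] (1 : E) f = f) : f = 0 := by
  obtain ⟨c, d, hcd⟩ : ∃ c d, y0 * d - y1 * c = 1 := by
    rcases hy with h | h
    · exact ⟨0, y0⁻¹, by field_simp; simp⟩
    · exact ⟨-y1⁻¹, 0, by field_simp; simp⟩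
  have hn : Algebra.norm F (1 : E) = 1 := map_one _
  have hn1 := norm_neg1 h2
  have dx : (!![y0, c; y1, d]).det = 1 := by rw [Matrix.det_fin_two]; simp; linear_combination hcd
  have dx' : (!![d, -c; -y1, y0]).det = 1 := by rw [Matrix.det_fin_two]; simp; linear_combination hcd
  have xx' : !![y0, c; y1, d] * !![d, -c; -y1, y0] = 1 := by
    ext i j; fin_cases i <;> fin_cases j <;> simp [Matrix.mul_apply, Fin.sum_univ_two]
    · linear_combination hcd
    · ring
    · ring
    · linear_combination hcd
  have x'x : !![d, -c; -y1, y0] * !![y0, c; y1, d] = 1 := by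
    ext i j; fin_cases i <;> fin_cases j <;> simp [Matrix.mul_apply, Fin.sum_univ_two]
    · linear_combination hcd
    · ring
    · ring
    · linear_combination hcd
  set f' := wr ψ !![d, -c; -y1, y0] (1 : E) f with hf'
  have ff' : f = wr ψ !![y0, c; y1, d] (1 : E) f' := (wr_cancel h2 _ _ dx dx' xx' hψ f).symm
  have hs : ∀ s : F, wr ψ !![1, -s; 0, 1] (1 : E) f' = f' := by
    intro s
    have dn : (!![1, -s; 0, 1]).det = 1 := by rw [Matrix.det_fin_two]; simp
    have dM : (!![1 + s * y0 * y1, - s * y0 ^ 2; s * y1 ^ 2, 1 - s * y0 * y1]).det = 1 := by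
      rw [Matrix.det_fin_two]; simp; ring
    have e : !![1 + s * y0 * y1, - s * y0 ^ 2; s * y1 ^ 2, 1 - s * y0 * y1] * !![y0, c; y1, d] = !![y0, c; y1, d] * !![1, -s; 0, 1] := by
      ext i j; fin_cases i <;> fin_cases j <;> simp [Matrix.mul_apply, Fin.sum_univ_two]
      · ring
      · linear_combination (- s * y0) * hcd
      · ring
      · linear_combination (- s * y1) * hcd
    have h1 := hf s
    rw [ff', ← wr_mul h2 ψ hψ _ _ 1 1 (by rw [dM, hn]) (by rw [dx, hn]) one_ne_zero one_ne_zero, e,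
      wr_mul h2 ψ hψ _ _ 1 1 (by rw [dx, hn]) (by rw [dn, hn]) one_ne_zero one_ne_zero] at h1
    have h4 := congrArg (wr ψ !![d, -c; -y1, y0] (1 : E)) h1
    rwa [wr_cancel h2 _ _ dx' dx x'x hψ, wr_cancel h2 _ _ dx' dx x'x hψ] at h4
  have hodd' : wr ψ 1 (-1 : E) f' = - f' := by
    rw [hf', ← wr_mul h2 ψ hψ _ _ _ _ (by rw [hn1]; simp) (by rw [dx', hn]) (by simp) one_ne_zero, one_mul, mul_one]
    have := wr_mul h2 ψ hψ !![d, -c; -y1, y0] 1 (1 : E) (-1) (by rw [dx', hn]) (by rw [hn1]; simp) one_ne_zero (by simp) f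
    rw [mul_one, one_mul] at this
    rw [this, hodd, map_neg]
  have hf0 : f' = 0 := by
    ext z
    by_cases hz : z = 0
    · have := congrFun hodd' z
      rw [wr_zero ψ 1 _ (b := 0) (d := 1) (by simp) (by simp) (by simp), hz] at this
      simp at this
      rw [hz]
      show f' 0 = 0
      linear_combination (1/2 : ℂ) * this
    · obtain ⟨k, hk⟩ := AddChar.ne_one_iff.1 hψ 
      have hz' := norm_ne (F := F) h2 hz
      have := congrFun (hs (- (k / Algebra.norm F z))) z
      rw [wr_zero ψ _ _ (b := k / Algebra.norm F z) (d := 1) (by simp) (by simp) (by simp)] at this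
      simp [div_mul_cancel₀ _ hz'] at this
      have h8 : (ψ k - 1) * f' z = 0 := by linear_combination this
      exact (mul_eq_zero.1 h8).resolve_left (sub_ne_zero.2 hk)
  rw [ff', hf0, map_zero]

theorem chi2_irr (hν : ν (-1) = -1) (hq : 1 < Nat.card F) : Simple (FDRep.of (Representation.coind (m2 E) (tau2 h2 hψ ν))) := by
  have : Module.Finite F E := Module.finite_of_finrank_pos (by omega)
  let V := Representation.coindV (m2 E) (tau2 h2 hψ ν)
  let R : Representation ℂ (PS F) V := Representation.coind (m2 E) (tau2 h2 hψ ν)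
  have Rap : ∀ a (f : V) x, (R a f).1 x = f.1 (x * a) := fun a f x => rfl
  have fap : ∀ (f : V) (n : HH F E) x, f.1 (m2 E n * x) = tau2 h2 hψ ν n (f.1 x) := fun f n x => f.2 n x
  have fW : ∀ (f : V) x, f.1 x ∈ W2 F ν := by
    intro f x
    rw [W2_iff h2 hψ ν]
    intro h hh
    rw [← fap, hh, one_mul]
  have f0 : ∀ (f : V) x, f.1 x 0 = 0 := fun f x => W2_zero h2 ν hν (fW f x)
  let Ψ : Qs F →* ℂˣ := MonoidHom.toHomUnits
    { toFun := fun u => ψ (u.1 0 1)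
      map_one' := by show ψ ((1 : G3 F) 0 1) = 1; simp
      map_mul' := by
        rintro ⟨_, a, b, c, rfl⟩ ⟨_, a', b', c', rfl⟩
        show ψ ((un a b c * un a' b' c') 0 1) = ψ (un a b c 0 1) * ψ (un a' b' c' 0 1)
        rw [un_mul, ← AddChar.map_add_eq_mul]; rfl }
  have hΨ : ∀ a b c h, (Ψ ⟨un a b c, h⟩ : ℂ) = ψ a := fun a b c h => rfl
  have hrun : ∀ a b c : F, rho (un a b c) = !![1, a; 0, 1] := by
    intro a b c
    ext i j; fin_cases i <;> fin_cases j <;> simp [rho, un]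
  have hunP : ∀ a b c : F, un a b c ∈ Ps F := fun a b c => ⟨rfl, rfl⟩
  have fun1 : ∀ (f : V) a b c x, f.1 (mk3 (un a b c) * x) = wr ψ !![1, a; 0, 1] (1 : E) (f.1 x) := by
    intro f a b c x
    have := fap f ⟨(un a b c, 1), hunP a b c, by show (rho (un a b c)).det = _; rw [hrun, Matrix.det_fin_two]; simp⟩ x
    rw [m2_apply, tau2_apply] at this
    simp only [hrun, Units.val_one, map_one, one_smul] at this
    exact this
  let ev : V →ₗ[ℂ] ℂ := { toFun := fun f => f.1 1 1, map_add' := fun _ _ => rfl, map_smul' := fun _ _ => rfl }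
  refine irr_of_ev R (mk3.comp (Qs F).subtype) Ψ ev ?_ ?_ ?_ ?_
  · intro v hv hv1
    have hv1' : v.1 1 1 = 0 := hv1
    have hv' : ∀ a b c x, v.1 (x * mk3 (un a b c)) = ψ a • v.1 x := by
      intro a b c x
      have := congrArg (fun f : V => f.1 x) (hv ⟨un a b c, a, b, c, rfl⟩)
      exact this
    have v10 : v.1 1 = 0 := by
      ext z
      by_cases hz : Algebra.norm F z = 1
      · have := fW v 1 z hz 1
        rw [hv1', one_mul] at this
        have z0 : z ≠ 0 := by
          rintro rfl; rw [Algebra.norm_zero] at hz; exact zero_ne_one hz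
        exact (mul_eq_zero.1 this).resolve_left ((Ne.isUnit z0).map ν).ne_zero
      · obtain ⟨k, hk⟩ := AddChar.ne_one_iff.1 hψ
        have hz' : Algebra.norm F z - 1 ≠ 0 := sub_ne_zero.2 hz
        set b := k / (Algebra.norm F z - 1) with hb
        have e1 := congrFun (hv' b 0 0 1) z
        have e2 := congrFun (fun1 v b 0 0 1) z
        rw [one_mul] at e1
        rw [mul_one, e1, wr_zero ψ _ _ (b := b) (d := 1) (by simp) (by simp) (by simp)] at e2
        have e3 : b * Algebra.norm F z = k + b := by rw [hb]; field_simp; ring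
        rw [div_one, e3, AddChar.map_add_eq_mul] at e2
        simp only [mul_one, inv_one, map_one, Pi.smul_apply, smul_eq_mul] at e2
        have e4 : (ψ k - 1) * (ψ b * v.1 1 z) = 0 := by linear_combination -e2
        rcases mul_eq_zero.1 e4 with h | h
        · exact absurd (sub_eq_zero.1 h) hk
        · exact (mul_eq_zero.1 h).resolve_left (AddChar.val_isUnit ψ b).ne_zero
    ext s : 2
    obtain ⟨g, rfl⟩ := mk3_surj s
    show v.1 (mk3 g) = 0
    by_cases hg : g ∈ Ps F
    · have : mk3 g ∈ (m2 E).range := by rw [m2_range h2]; exact ⟨g, hg, rfl⟩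
      obtain ⟨h, hh⟩ := this
      rw [← hh, ← mul_one (m2 E h), fap, v10, map_zero]
    · set y0 := g 0 0 * g 2 1 - g 0 1 * g 2 0 with hy0
      set y1 := g 1 0 * g 2 1 - g 1 1 * g 2 0 with hy1
      have hy : y0 ≠ 0 ∨ y1 ≠ 0 := by
        by_contra! hc
        rw [hy0, hy1] at hc
        have hd := det3 g
        apply hg
        constructor
        · show g 2 0 = 0
          linear_combination (- g 2 0) * hd + (g 2 0 * g 0 2 + g 2 2 * 0) * hc.2 - (g 2 0 * g 1 2) * hc.1 + g 2 2 * (g 1 0 * hc.1 - g 0 0 * hc.2)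
        · show g 2 1 = 0
          linear_combination (- g 2 1) * hd + (g 2 1 * g 0 2) * hc.2 - (g 2 1 * g 1 2) * hc.1 + g 2 2 * (g 1 1 * hc.1 - g 0 1 * hc.2)
      apply fixed_zero h2 hψ y0 y1 hy
      · ext z
        rw [wr_zero ψ 1 _ (b := 0) (d := 1) (by simp) (by simp) (by simp)]
        have := fW v (mk3 g) (-1) (norm_neg1 h2) z
        rw [hν] at this
        simp at this ⊢
        rw [← this, neg_neg]
      · intro s
        have hu := hv' 0 (s * g 2 1) (- s * g 2 0) (mk3 g)
        rw [AddChar.map_zero_eq_one, one_smul] at hu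
        let p := g * un 0 (s * g 2 1) (- s * g 2 0) * g⁻¹
        have ep : mk3 g * mk3 (un 0 (s * g 2 1) (- s * g 2 0)) = mk3 p * mk3 g := by
          rw [← map_mul, ← map_mul]; congr 1; simp [p]
        have hd := det3 g
        have u00 : ∀ a b c : F, (un a b c) 0 0 = 1 := fun _ _ _ => rfl
        have u01 : ∀ a b c : F, (un a b c) 0 1 = a := fun _ _ _ => rfl
        have u02 : ∀ a b c : F, (un a b c) 0 2 = b := fun _ _ _ => rfl
        have u10 : ∀ a b c : F, (un a b c) 1 0 = 0 := fun _ _ _ => rfl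
        have u11 : ∀ a b c : F, (un a b c) 1 1 = 1 := fun _ _ _ => rfl
        have u12 : ∀ a b c : F, (un a b c) 1 2 = c := fun _ _ _ => rfl
        have u20 : ∀ a b c : F, (un a b c) 2 0 = 0 := fun _ _ _ => rfl
        have u21 : ∀ a b c : F, (un a b c) 2 1 = 0 := fun _ _ _ => rfl
        have u22 : ∀ a b c : F, (un a b c) 2 2 = 1 := fun _ _ _ => rfl
        have pij : ∀ i j, p i j = (1 : G3 F) i j + s * (g i 0 * g 2 1 - g i 1 * g 2 0) * (g⁻¹) 2 j := by
          intro i j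
          have h1 : (1 : G3 F) i j = (g * g⁻¹) i j := by rw [mul_inv_cancel]
          rw [h1, gmul, gmul, gmul, gmul, gmul, u00, u01, u02, u10, u11, u12, u20, u21, u22]
          ring
        have i20 : (g⁻¹) 2 0 = y1 := by
          rw [adj2, Matrix.adjugate_fin_three, hy1]; simp
        have i21 : (g⁻¹) 2 1 = - y0 := by
          rw [adj2, Matrix.adjugate_fin_three, hy0]; simp; ring
        have p20 : p 2 0 = 0 := by rw [pij, show s * (g 2 0 * g 2 1 - g 2 1 * g 2 0) = 0 by ring]; simp
        have p21 : p 2 1 = 0 := by rw [pij, show s * (g 2 0 * g 2 1 - g 2 1 * g 2 0) = 0 by ring]; simp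
        have p22 : p 2 2 = 1 := by rw [pij, show s * (g 2 0 * g 2 1 - g 2 1 * g 2 0) = 0 by ring]; simp
        have hrp : rho p = !![1 + s * y0 * y1, - s * y0 ^ 2; s * y1 ^ 2, 1 - s * y0 * y1] := by
          ext i j
          fin_cases i <;> fin_cases j <;> simp [rho, p22, pij, i20, i21, hy0, hy1, -Matrix.SpecialLinearGroup.coe_inv] <;> ring
        have dM : (rho p).det = 1 := by
          rw [hrp, Matrix.det_fin_two]; simp; ring
        have := fap v ⟨(p, 1), ⟨p20, p21⟩, by show (rho p).det = _; rw [dM]; simp⟩ (mk3 g)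
        rw [m2_apply, tau2_apply] at this
        simp only [hrp, Units.val_one, map_one, one_smul] at this
        rw [← this, ← ep]
        exact hu
  · intro v hv
    by_contra! hc
    apply hv
    ext s z
    show v.1 s z = 0
    by_cases hz : z = 0
    · rw [hz]; exact f0 v s
    · set y := Algebra.norm F z with hy
      have y0 : y ≠ 0 := norm_ne h2 hz
      let p : G3 F := ⟨!![y, 0, 0; 0, 1, 0; 0, 0, y⁻¹], by simp [Matrix.det_fin_three, y0]⟩
      have hrp : rho p = !![y ^ 2, 0; 0, y] := by
        ext i j
        fin_cases i <;> fin_cases j <;> simp [rho, p]; ring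
      have h1 : algebraMap F E y ≠ 0 := by simpa using y0
      have hnn : Algebra.norm F (algebraMap F E y * z) = y ^ 3 := by
        rw [map_mul, Algebra.norm_algebraMap, h2, ← hy]; ring
      have := fap v ⟨(p, Units.mk0 (algebraMap F E y * z) (mul_ne_zero h1 hz)), ⟨rfl, rfl⟩, by
        show (rho p).det = _
        rw [hrp, Matrix.det_fin_two, Units.val_mk0, hnn]; simp; ring⟩ s
      rw [m2_apply, tau2_apply] at this
      simp only [hrp, Units.val_mk0] at this
      have h4 := congrFun this 1
      have h5 : v.1 (1 * (mk3 p * s)) 1 = 0 := hc (mk3 p * s)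
      rw [one_mul] at h5
      rw [h5, Pi.smul_apply, wr_zero ψ _ _ (b := 0) (d := y) (by simp) (by simp) (by simp)] at h4
      have h6 : 1 * (algebraMap F E y * z) * algebraMap F E y⁻¹ = z := by
        rw [map_inv₀]; field_simp
      rw [h6] at h4
      have h7 : ν (algebraMap F E y * z) ≠ 0 := ((Ne.isUnit (mul_ne_zero h1 hz)).map ν).ne_zero
      rw [zero_div, zero_mul, AddChar.map_zero_eq_one, one_mul] at h4
      exact (mul_eq_zero.1 h4.symm).resolve_left h7
  · rintro ⟨_, a, b, c, rfl⟩ v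
    show v.1 (1 * mk3 (un a b c)) 1 = ψ a * v.1 1 1
    rw [one_mul, ← mul_one (mk3 (un a b c)), fun1, wr_zero ψ _ _ (b := a) (d := 1) (by simp) (by simp) (by simp)]
    simp
  · apply Module.nontrivial_of_finrank_pos (R := ℂ)
    rw [chi2_finrank h2 hψ ν hν]
    have : 0 < Nat.card F - 1 := by omega
    positivity

end ChiTwoB


theorem coind_char_inv {H A W : Type} [Group H] [Group A] [Finite A] [AddCommGroup W] [Module ℂ W]
    [Module.Finite ℂ W]
    (m : H →* A) (τ : Representation ℂ H W) (φ : MulAut A) (j : W →ₗ[ℂ] W) (hj : Function.Injective j)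
    (h : ∀ x : H, ∃ y : H, φ (m x) = m y ∧ ∀ w, τ x (j w) = j (τ y w)) (s : A) :
    (FDRep.of (Representation.coind m τ)).character (φ s) = (FDRep.of (Representation.coind m τ)).character s := by
  let V := Representation.coindV m τ
  let R : Representation ℂ A V := Representation.coind m τ
  have fap : ∀ (f : V) (n : H) x, f.1 (m n * x) = τ n (f.1 x) := fun f n x => f.2 n x
  let J : V →ₗ[ℂ] V :=
    { toFun := fun f => ⟨fun a => j (f.1 (φ a)), by
        intro x a
        obtain ⟨y, hy, hw⟩ := h x
        show j (f.1 (φ (m x * a))) = τ x (j (f.1 (φ a)))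
        rw [hw, map_mul, hy, fap]⟩
      map_add' := fun f g => by
        ext a
        exact map_add j _ _
      map_smul' := fun c f => by
        ext a
        exact map_smul j _ _ }
  have hJ : Function.Injective J := by
    rw [injective_iff_map_eq_zero]
    intro f hf
    ext a
    have h1 : j (f.1 (φ (φ⁻¹ a))) = 0 := congrFun (congrArg Subtype.val hf) (φ⁻¹ a)
    rw [MulAut.apply_inv_self] at h1
    exact hj (h1.trans (map_zero j).symm)
  let e := LinearEquiv.ofBijective J ⟨hJ, LinearMap.injective_iff_surjective.1 hJ⟩
  have hc : ∀ f, J (R (φ s) f) = R s (J f) := by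
    intro f
    ext a
    show j (f.1 (φ a * φ s)) = j (f.1 (φ (a * s)))
    rw [map_mul]
  have : R s = e.conj (R (φ s)) := by
    ext f : 1
    rw [LinearEquiv.conj_apply_apply]
    show _ = J (R (φ s) (e.symm f))
    rw [hc]
    show _ = R s (e (e.symm f))
    rw [e.apply_symm_apply]
  show LinearMap.trace ℂ V (R (φ s)) = LinearMap.trace ℂ V (R s)
  rw [this, LinearMap.trace_conj']

section Inv

variable {F : Type} [Field F] [Fintype F] [DecidableEq F] {E : Type} [Field E] [Fintype E] [Algebra F E]
variable (h2 : Module.finrank F E = 2) {ψ : AddChar F ℂ} (hψ : ψ ≠ 1) (ν : MulChar E ℂ)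

/-- precomposition -/
def pre (σE : E →+* E) : (E → ℂ) →ₗ[ℂ] (E → ℂ) where
  toFun f z := f (σE z)
  map_add' _ _ := rfl
  map_smul' _ _ := rfl

theorem pre_inj (σE : E →+* E) : Function.Injective (pre σE) := by
  intro f g h
  ext z
  obtain ⟨w, rfl⟩ := (Finite.injective_iff_surjective.1 σE.injective) z
  exact congrFun h w

theorem wr_pre (σ : F →+* F) (σE : E →+* E) (hN : ∀ z, Algebra.norm F (σE z) = σ (Algebra.norm F z))
    (hT : ∀ z, Algebra.trace F E (σE z) = σ (Algebra.trace F E z))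
    (ha : ∀ c, algebraMap F E (σ c) = σE (algebraMap F E c))
    (hs : ∀ x, ψ (σ x) = ψ x) (M : Matrix (Fin 2) (Fin 2) F) (t : E) (f : E → ℂ) :
    wr ψ M t (pre σE f) = pre σE (wr ψ (M.map σ) (σE t) f) := by
  ext z
  show _ = wr ψ (M.map σ) (σE t) f (σE z)
  by_cases hc : M 1 0 = 0
  · rw [wr_zero ψ M t rfl rfl hc, wr_zero ψ (M.map σ) (σE t) (b := σ (M 0 1)) (d := σ (M 1 1)) rfl rfl (by simp [hc])]
    rw [hN, ← map_div₀, ← map_mul, hs, ← map_inv₀, ha, ← map_mul, ← map_mul]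
    rfl
  · rw [wr_ne ψ M t rfl rfl rfl hc, wr_ne ψ (M.map σ) (σE t) (a := σ (M 0 0)) (c := σ (M 1 0)) (d := σ (M 1 1)) rfl rfl rfl (by simpa using hc)]
    congr 1
    refine Fintype.sum_bijective σE ⟨σE.injective, Finite.injective_iff_surjective.1 σE.injective⟩ _ _ ?_
    intro w
    have : cjE F (σE w) = σE (cjE F w) := by rw [cjE, cjE, map_pow]
    rw [this, ← map_mul, ← map_mul, hT, hN, hN, ← map_mul, ← map_mul, ← map_sub, ← map_add, ← map_div₀, hs]
    rfl

theorem chi2_inv (φ : MulAut (PS F)) (σ : F →+* F) (σE : E →+* E) (hN : ∀ z, Algebra.norm F (σE z) = σ (Algebra.norm F z))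
    (hT : ∀ z, Algebra.trace F E (σE z) = σ (Algebra.trace F E z))
    (ha : ∀ c, algebraMap F E (σ c) = σE (algebraMap F E c))
    (hs : ∀ x, ψ (σ x) = ψ x) (hν : ∀ z, ν (σE z) = ν z) (B : Matrix (Fin 2) (Fin 2) F) (hB : B.det ≠ 0)
    (hφ : ∀ g ∈ Ps F, ∃ g' ∈ Ps F, φ (mk3 g) = mk3 g' ∧ (rho g).map σ * B = B * rho g') (s : PS F) :
    (FDRep.of (Representation.coind (m2 E) (tau2 h2 hψ ν))).character (φ s) =
      (FDRep.of (Representation.coind (m2 E) (tau2 h2 hψ ν))).character s := by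
  have : Module.Finite F E := Module.finite_of_finrank_pos (by omega)
  obtain ⟨tB, htB⟩ := FiniteField.norm_surjective F E B.det
  have tB0 : tB ≠ 0 := by
    rintro rfl; rw [Algebra.norm_zero] at htB; exact hB htB.symm
  refine coind_char_inv _ _ _ ((pre σE).comp (wr ψ B tB)) ?_ ?_ s
  · rw [LinearMap.coe_comp]
    refine (pre_inj σE).comp ?_
    intro f f' h
    have hB' : B.det * (B⁻¹).det = 1 := by
      rw [← Matrix.det_mul, Matrix.mul_nonsing_inv _ (Ne.isUnit hB), Matrix.det_one]
    have k : ∀ f, wr ψ B⁻¹ tB⁻¹ (wr ψ B tB f) = f := by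
      intro f
      rw [← wr_mul h2 ψ hψ _ _ _ _ (by
        have h5 : B.det * Algebra.norm F tB⁻¹ = 1 := by rw [← htB, ← map_mul, mul_inv_cancel₀ tB0, map_one]
        exact (eq_inv_of_mul_eq_one_right hB').trans (eq_inv_of_mul_eq_one_right h5).symm) htB.symm (inv_ne_zero tB0) tB0,
        Matrix.nonsing_inv_mul _ (Ne.isUnit hB), inv_mul_cancel₀ tB0, wr_one]
      rfl
    rw [← k f, h, k]
  · rintro ⟨⟨g, t⟩, hg, ht⟩
    obtain ⟨g', hg', e1, e2⟩ := hφ g hg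
    have t0 : σE t ≠ 0 := by simp
    have hd1 : ((rho g).map σ).det = Algebra.norm F (σE t) := by
      rw [hN]; exact (RingHom.map_det σ (rho g)).symm.trans (congrArg σ ht)
    have hd : (rho g').det = Algebra.norm F (σE t) := by
      have := congrArg Matrix.det e2
      rw [Matrix.det_mul, Matrix.det_mul, mul_comm] at this
      rw [← mul_left_cancel₀ hB this, hd1]
    refine ⟨⟨(g', Units.mk0 _ t0), hg', hd⟩, e1, ?_⟩
    intro w
    rw [tau2_apply, tau2_apply]
    simp only [Units.val_mk0, LinearMap.comp_apply]
    rw [hν, map_smul, map_smul, wr_pre σ σE hN hT ha hs,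
      ← wr_mul h2 ψ hψ _ _ _ _ hd1 htB.symm t0 tB0, e2, mul_comm (σE _) tB,
      wr_mul h2 ψ hψ _ _ _ _ htB.symm hd tB0 t0]

end Inv


section AutStr

variable {F : Type} [Field F]

theorem u00 (a b c : F) : (un a b c) 0 0 = 1 := rfl
theorem u01 (a b c : F) : (un a b c) 0 1 = a := rfl
theorem u02 (a b c : F) : (un a b c) 0 2 = b := rfl
theorem u10 (a b c : F) : (un a b c) 1 0 = 0 := rfl
theorem u11 (a b c : F) : (un a b c) 1 1 = 1 := rfl
theorem u12 (a b c : F) : (un a b c) 1 2 = c := rfl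
theorem u20 (a b c : F) : (un a b c) 2 0 = 0 := rfl
theorem u21 (a b c : F) : (un a b c) 2 1 = 0 := rfl
theorem u22 (a b c : F) : (un a b c) 2 2 = 1 := rfl

theorem conjz_entry (h : G3 F) (t : F) (i j : Fin 3) :
    (h * un 0 t 0 * h⁻¹) i j = (1 : G3 F) i j + t * (h i 0 * (h⁻¹) 2 j) := by
  have h1 : (1 : G3 F) i j = (h * h⁻¹) i j := by rw [mul_inv_cancel]
  rw [h1, gmul, gmul, gmul, gmul, gmul, u00, u01, u02, u10, u11, u12, u20, u21, u22]
  ring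

theorem conj_trace (h x : G3 F) : (h * x * h⁻¹).1.trace = x.1.trace := by
  rw [Matrix.SpecialLinearGroup.coe_mul, Matrix.trace_mul_comm, ← Matrix.SpecialLinearGroup.coe_mul, ← mul_assoc,
    inv_mul_cancel, one_mul]

theorem ac_zero (h3 : (3 : F) ≠ 0) {a b c t : F} {h : G3 F} (e : mk3 (un a b c) = mk3 h * mk3 (un 0 t 0) * (mk3 h)⁻¹) :
    a * c = 0 := by
  have e' : un a b c = h * un 0 t 0 * h⁻¹ := by
    apply mk3_inj h3 (un_trace _ _ _)
    · rw [conj_trace, un_trace]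
    · rw [map_mul, map_mul, map_inv]; exact e
  have e2 : un a b c * un a b c = h * un 0 (t + t) 0 * h⁻¹ := by
    have : (un 0 (t + t) 0 : G3 F) = un 0 t 0 * un 0 t 0 := by rw [un_mul]; simp
    rw [this, e']; group
  have k1 : (un a b c * un a b c) 0 2 = _ := congrArg (fun g : G3 F => g 0 2) e2
  have k2 : (un a b c) 0 2 = _ := congrArg (fun g : G3 F => g 0 2) e'
  rw [un_mul] at k1
  simp only [conjz_entry, u02] at k1 k2
  have : (1 : G3 F) 0 2 = 0 := by simp
  rw [this] at k1 k2
  linear_combination k1 - 2 * k2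

theorem conj_of_ac {a b c : F} (e : a * c = 0) : ∃ (h : G3 F) (t : F), un a b c = h * un 0 t 0 * h⁻¹ := by
  have fin : ∀ (M : Matrix (Fin 3) (Fin 3) F) (hM : M.det = 1) (t : F), (un a b c).1 * M = M * (un 0 t 0).1 → ∃ (h : G3 F) (t : F), un a b c = h * un 0 t 0 * h⁻¹ := by
    intro M hM t h
    let g : G3 F := ⟨M, hM⟩
    have h : un a b c * g = g * un 0 t 0 := Subtype.ext h
    exact ⟨g, t, by rw [← h]; group⟩
  have fin' : ∀ (M : Matrix (Fin 3) (Fin 3) F) (hM : M.det = 1) (t : F), M * (un a b c).1 = (un 0 t 0).1 * M → ∃ (h : G3 F) (t : F), un a b c = h * un 0 t 0 * h⁻¹ := by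
    intro M hM t h
    let g : G3 F := ⟨M, hM⟩
    have h : g * un a b c = un 0 t 0 * g := Subtype.ext h
    refine ⟨g⁻¹, t, ?_⟩
    rw [mul_assoc, inv_inv, ← h]; group
  rcases mul_eq_zero.1 e with rfl | rfl
  · by_cases hb : b = 0
    · by_cases hc : c = 0
      · exact ⟨1, 0, by rw [hb, hc]; simp⟩
      · refine fin !![b, -c⁻¹, 0; c, 0, 0; 0, 0, 1] (by simp [Matrix.det_fin_three, hc]) 1 ?_
        ext i j
        fin_cases i <;> fin_cases j <;> simp [un, Matrix.mul_apply, Fin.sum_univ_three, *]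
    · refine fin !![b, 0, 0; c, b⁻¹, 0; 0, 0, 1] (by simp [Matrix.det_fin_three, hb]) 1 ?_
      ext i j
      fin_cases i <;> fin_cases j <;> simp [un, Matrix.mul_apply, Fin.sum_univ_three, *]
  · by_cases hb : b = 0
    · by_cases ha : a = 0
      · exact ⟨1, 0, by rw [hb, ha]; simp⟩
      · refine fin' !![a⁻¹, 0, 0; 0, 0, -1; 0, a, b] (by simp [Matrix.det_fin_three, ha]) a⁻¹ ?_
        ext i j
        fin_cases i <;> fin_cases j <;> simp [un, Matrix.mul_apply, Fin.sum_univ_three, *]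
    · refine fin' !![b⁻¹, 0, 0; 0, 1, 0; 0, a, b] (by simp [Matrix.det_fin_three, hb]) b⁻¹ ?_
      ext i j
      fin_cases i <;> fin_cases j <;> simp [un, Matrix.mul_apply, Fin.sum_univ_three, *]

variable [Fintype F] (h3 : (3 : F) ≠ 0)
include h3

theorem ac_pres (φ : MulAut (PS F)) (hQ : ∀ x, φ x ∈ Qb F ↔ x ∈ Qb F) {a b c : F} (e : a * c = 0) :
    ∃ a' b' c', a' * c' = 0 ∧ φ (mk3 (un a b c)) = mk3 (un a' b' c') := by
  obtain ⟨a', b', c', h'⟩ := mem_Qb.1 ((hQ (mk3 (un a b c))).2 (mem_Qb.2 ⟨a, b, c, rfl⟩))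
  refine ⟨a', b', c', ?_, h'⟩
  obtain ⟨h, t, hh⟩ := conj_of_ac (b := b) e
  obtain ⟨t', ht'⟩ := (Nst_of_Qb h3 φ hQ (mk3 (un 0 t 0))).2 ⟨t, rfl⟩
  obtain ⟨k, hk⟩ := mk3_surj (φ (mk3 h))
  apply ac_zero h3 (h := k) (t := t') (b := b')
  rw [← h', hh, map_mul, map_mul, map_inv, map_mul, map_mul, map_inv, hk, ht']

/-- alternative for the images -/
theorem U_alt (φ : MulAut (PS F)) (hQ : ∀ x, φ x ∈ Qb F ↔ x ∈ Qb F) (P : F → F → F → Prop)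
    (hP : ∀ a b c, P a b c → a * c = 0) (hPm : ∀ a b c a' b' c', P a b c → P a' b' c' → P (a + a') (b + b' + a * c') (c + c')) :
    (∀ a b c, P a b c → ∃ b' c', φ (mk3 (un a b c)) = mk3 (un 0 b' c')) ∨
    (∀ a b c, P a b c → ∃ a' b', φ (mk3 (un a b c)) = mk3 (un a' b' 0)) := by
  by_contra! hc
  obtain ⟨⟨a1, b1, c1, h1, k1⟩, a2, b2, c2, h2, k2⟩ := hc
  obtain ⟨x1, y1, z1, e1, f1⟩ := ac_pres h3 φ hQ (b := b1) (hP _ _ _ h1)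
  obtain ⟨x2, y2, z2, e2, f2⟩ := ac_pres h3 φ hQ (b := b2) (hP _ _ _ h2)
  have hx1 : x1 ≠ 0 := by rintro rfl; exact k1 _ _ f1
  have hz2 : z2 ≠ 0 := by rintro rfl; exact k2 _ _ f2
  have hz1 : z1 = 0 := (mul_eq_zero.1 e1).resolve_left hx1
  have hx2 : x2 = 0 := (mul_eq_zero.1 e2).resolve_right hz2
  obtain ⟨x, y, z, e, f⟩ := ac_pres h3 φ hQ (b := b1 + b2 + a1 * c2) (hP _ _ _ (hPm _ _ _ _ _ _ h1 h2))
  rw [← mkun_mul, map_mul, f1, f2, mkun_mul] at f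
  obtain ⟨q1, -, q2⟩ := mkun_inj h3 f
  rw [← q1, ← q2, hz1, hx2, add_zero, zero_add] at e
  exact (mul_ne_zero hx1 hz2) e

theorem U_stab (φ : MulAut (PS F)) (hQ : ∀ x, φ x ∈ Qb F ↔ x ∈ Qb F) (N : ℕ) (hN : Odd N) (hφ : φ ^ N = 1) :
    ∀ b c, ∃ b' c', φ (mk3 (un 0 b c)) = mk3 (un 0 b' c') := by
  rcases U_alt h3 φ hQ (fun a b c => a = 0) (by rintro a b c rfl; simp) (by rintro a b c a' b' c' rfl rfl; simp) with h | h
  · exact fun b c => h 0 b c rfl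
  rcases U_alt h3 φ hQ (fun a b c => c = 0) (by rintro a b c rfl; simp) (by rintro a b c a' b' c' rfl rfl; simp) with k | k
  · have h2 : ∀ n : ℕ, ∀ b c, ∃ b' c', (φ ^ (2 * n)) (mk3 (un 0 b c)) = mk3 (un 0 b' c') := by
      intro n
      induction n with
      | zero => intro b c; exact ⟨b, c, rfl⟩
      | succ n ih =>
        intro b c
        obtain ⟨a', b', h'⟩ := h 0 b c rfl
        obtain ⟨b'', c'', h''⟩ := k a' b' 0 rfl
        obtain ⟨b3, c3, h3'⟩ := ih b'' c''
        refine ⟨b3, c3, ?_⟩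
        rw [mul_add, mul_one, pow_add, MulAut.mul_apply, pow_two, MulAut.mul_apply, h', h'', h3']
    obtain ⟨m, hm⟩ := hN
    intro b c
    obtain ⟨b', c', h'⟩ := h2 (m + 1) b c
    have : 2 * (m + 1) = N + 1 := by omega
    rw [this, pow_succ, hφ, one_mul] at h'
    exact ⟨b', c', h'⟩
  · exfalso
    obtain ⟨a, b, c, e⟩ := mem_Qb.1 ((hQ (φ⁻¹ (mk3 (un 0 0 1)))).1 (by
      rw [MulAut.apply_inv_self]; exact mem_Qb.2 ⟨_, _, _, rfl⟩))
    have e1 : mk3 (un a b c) = mk3 (un 0 b c) * mk3 (un a 0 0) := by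
      rw [mkun_mul]; simp
    obtain ⟨a1, b1, k1⟩ := h 0 b c rfl
    obtain ⟨a2, b2, k2⟩ := k a 0 0 rfl
    have e2 := congrArg φ e
    rw [MulAut.apply_inv_self, e1, map_mul, k1, k2, mkun_mul] at e2
    have := (mkun_inj h3 e2).2.2
    simp at this

end AutStr


section AutStr2

variable {F : Type} [Field F]

theorem P_conj {g : G3 F} (hg : g ∈ Ps F) (b c : F) : g * un 0 b c =
    un 0 (rho g 0 0 * b + rho g 0 1 * c) (rho g 1 0 * b + rho g 1 1 * c) * g := by
  have h := P22 hg
  have r00 : rho g 0 0 = g 0 0 / g 2 2 := rfl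
  have r01 : rho g 0 1 = g 0 1 / g 2 2 := rfl
  have r10 : rho g 1 0 = g 1 0 / g 2 2 := rfl
  have r11 : rho g 1 1 = g 1 1 / g 2 2 := rfl
  have a0 : g 2 0 = 0 := hg.1
  have a1 : g 2 1 = 0 := hg.2
  have key : ∀ i j, (g * un 0 b c) i j = (un 0 (rho g 0 0 * b + rho g 0 1 * c) (rho g 1 0 * b + rho g 1 1 * c) * g) i j := by
    intro i j
    rw [gmul, gmul]
    fin_cases i <;> fin_cases j <;>
      simp only [Fin.zero_eta, Fin.mk_one, Fin.reduceFinMk, u00, u01, u02, u10, u11, u12, u20, u21, u22, a0, a1, r00, r01, r10, r11] <;>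
      field_simp <;> ring
  ext i j
  exact key i j

theorem Ps_of_norm (h3 : (3 : F) ≠ 0) (g : G3 F)
    (h : ∀ b c, ∃ b' c', mk3 g * mk3 (un 0 b c) = mk3 (un 0 b' c') * mk3 g) : g ∈ Ps F := by
  have key : ∀ b c, g 2 0 * b + g 2 1 * c = 0 := by
    intro b c
    obtain ⟨b', c', e⟩ := h b c
    have e1 : g * un 0 b c * g⁻¹ = un 0 b' c' := by
      apply mk3_inj h3
      · rw [conj_trace, un_trace]
      · exact un_trace _ _ _
      · rw [map_mul, map_mul, map_inv, e, mul_inv_cancel_right]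
    have e2 : g * un 0 b c = un 0 b' c' * g := by rw [← e1]; group
    have e3 : (g * un 0 b c) 2 2 = (un 0 b' c' * g) 2 2 := by rw [e2]
    rw [gmul, gmul, u02, u12, u20, u21, u22, u22] at e3
    linear_combination e3
  exact ⟨by simpa using key 1 0, by simpa using key 0 1⟩

variable [Fintype F] (h3 : (3 : F) ≠ 0)
include h3

theorem aut_struct (φ : MulAut (PS F)) (hQ : ∀ x, φ x ∈ Qb F ↔ x ∈ Qb F) (N : ℕ) (hN : Odd N) (hφ : φ ^ N = 1) :
    ∃ (σ : F →+* F) (B : Matrix (Fin 2) (Fin 2) F), B.det ≠ 0 ∧ (∀ x, σ^[N] x = x) ∧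
      ∀ g ∈ Ps F, ∃ g' ∈ Ps F, φ (mk3 g) = mk3 g' ∧ (rho g).map σ * B = B * rho g' := by
  have hU := U_stab h3 φ hQ N hN hφ
  have hUi : ∀ b c, ∃ b' c', φ⁻¹ (mk3 (un 0 b c)) = mk3 (un 0 b' c') := by
    have hp : ∀ n : ℕ, ∀ b c, ∃ b' c', (φ ^ n) (mk3 (un 0 b c)) = mk3 (un 0 b' c') := by
      intro n
      induction n with
      | zero => intro b c; exact ⟨b, c, rfl⟩
      | succ n ih =>
        intro b c
        obtain ⟨b1, c1, e1⟩ := hU b c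
        obtain ⟨b2, c2, e2⟩ := ih b1 c1
        exact ⟨b2, c2, by rw [pow_succ, MulAut.mul_apply, e1, e2]⟩
    obtain ⟨m, hm⟩ := hN
    have : φ⁻¹ = φ ^ (N - 1) := by
      rw [inv_eq_iff_mul_eq_one, ← pow_succ', show N - 1 + 1 = N by omega, hφ]
    rw [this]
    exact hp _
  choose f0 f1 hf using hU
  have hadd : ∀ b c b' c', f0 (b + b') (c + c') = f0 b c + f0 b' c' ∧ f1 (b + b') (c + c') = f1 b c + f1 b' c' := by
    intro b c b' c'
    have e := congrArg φ (mkun_mul 0 b c 0 b' c')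
    rw [map_mul, hf, hf, mkun_mul, zero_mul, add_zero, zero_mul, add_zero, add_zero, hf] at e
    obtain ⟨-, e1, e2⟩ := mkun_inj h3 e
    exact ⟨e1.symm, e2.symm⟩
  have hinj : ∀ b c, f0 b c = 0 → f1 b c = 0 → b = 0 ∧ c = 0 := by
    intro b c e0 e1
    have := hf b c
    rw [e0, e1, un_one, map_one, map_eq_one_iff φ φ.injective, ← map_one mk3, ← un_one] at this
    exact (mkun_inj h3 this).2
  have hz : f0 0 0 = 0 ∧ f1 0 0 = 0 := by
    have := hadd 0 0 0 0
    simpa using this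
  -- action of the parabolic
  have hP : ∀ g ∈ Ps F, ∀ g', φ (mk3 g) = mk3 g' → g' ∈ Ps F := by
    intro g hg g' e
    apply Ps_of_norm h3
    intro b c
    obtain ⟨b1, c1, e1⟩ := hUi b c
    have e2 : mk3 (un 0 b c) = φ (mk3 (un 0 b1 c1)) := by rw [← e1, MulAut.apply_inv_self]
    rw [← e, e2, ← map_mul, ← map_mul mk3, P_conj hg, map_mul, map_mul, hf]
    exact ⟨_, _, rfl⟩
  have hact : ∀ g ∈ Ps F, ∀ g', φ (mk3 g) = mk3 g' → ∀ b c,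
      f0 (rho g 0 0 * b + rho g 0 1 * c) (rho g 1 0 * b + rho g 1 1 * c) = rho g' 0 0 * f0 b c + rho g' 0 1 * f1 b c ∧
      f1 (rho g 0 0 * b + rho g 0 1 * c) (rho g 1 0 * b + rho g 1 1 * c) = rho g' 1 0 * f0 b c + rho g' 1 1 * f1 b c := by
    intro g hg g' e b c
    have hg' := hP g hg g' e
    have e1 := congrArg (fun x => φ (mk3 x)) (P_conj hg b c)
    simp only [map_mul] at e1
    rw [hf, hf, e, ← map_mul, P_conj hg', map_mul] at e1
    obtain ⟨-, e2, e3⟩ := mkun_inj h3 (mul_right_cancel e1)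
    exact ⟨e2.symm, e3.symm⟩
  have hrun : ∀ a b c : F, rho (un a b c) = !![1, a; 0, 1] := by
    intro a b c
    ext i j; fin_cases i <;> fin_cases j <;> simp [rho, un]
  -- upper unipotents
  have hup : ∀ s, ∃ α, ∀ b c, f0 (b + s * c) c = f0 b c + α * f1 b c ∧ f1 (b + s * c) c = f1 b c := by
    intro s
    obtain ⟨a', b', c', e⟩ := mem_Qb.1 ((hQ (mk3 (un s 0 0))).2 (mem_Qb.2 ⟨s, 0, 0, rfl⟩))
    refine ⟨a', fun b c => ?_⟩
    have := hact (un s 0 0) ⟨rfl, rfl⟩ _ e b c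
    rw [hrun, hrun] at this
    simpa using this
  choose α hα using hup
  have hlow : ∀ s, ∃ (n0 : F) (n1 : F × F × F), ∀ b, f0 b (s * b) = n0 * f0 b 0 + n1.1 * f1 b 0 ∧ f1 b (s * b) = n1.2.1 * f0 b 0 + n1.2.2 * f1 b 0 := by
    intro s
    let g : G3 F := ⟨!![1, 0, 0; s, 1, 0; 0, 0, 1], by simp [Matrix.det_fin_three]⟩
    obtain ⟨g', hg'⟩ := mk3_surj (φ (mk3 g))
    have hr : rho g = !![1, 0; s, 1] := by
      ext i j; fin_cases i <;> fin_cases j <;> simp [rho, g]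
    refine ⟨rho g' 0 0, (rho g' 0 1, rho g' 1 0, rho g' 1 1), fun b => ?_⟩
    have := hact g ⟨rfl, rfl⟩ _ hg'.symm b 0
    rw [hr] at this
    simpa using this
  have a1 : ∀ s x, f0 (s * x) 0 = α s * f1 0 x ∧ f1 (s * x) 0 = 0 := by
    intro s x
    have e1 := hα s 0 x
    have e2 := hadd (s * x) 0 0 x
    simp only [zero_add, add_zero] at e1 e2
    rw [e1.1, e1.2] at e2
    constructor
    · linear_combination -e2.1
    · linear_combination -e2.2
  have g1 : ∀ x, f1 x 0 = 0 := fun x => by simpa using (a1 1 x).2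
  have gx : ∀ x, f0 x 0 = α 1 * f1 0 x := fun x => by simpa using (a1 1 x).1
  have gs : ∀ s, f0 s 0 = α s * f1 0 1 := fun s => by simpa using (a1 s 1).1
  set γ := f0 1 0 with hγ
  have γ0 : γ ≠ 0 := by
    intro h
    exact one_ne_zero (hinj 1 0 h (g1 1)).1
  have gmulx : ∀ s x, f0 (s * x) 0 * γ = f0 s 0 * f0 x 0 := by
    intro s x
    rw [(a1 s x).1, hγ, gs s, gx 1, gx x]; ring
  let σ : F →+* F :=
    { toFun := fun x => f0 x 0 / γ
      map_one' := div_self γ0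
      map_mul' := fun x y => by
        have := gmulx x y
        show f0 (x * y) 0 / γ = f0 x 0 / γ * (f0 y 0 / γ)
        field_simp
        linear_combination this
      map_zero' := by show f0 0 0 / γ = 0; rw [hz.1, zero_div]
      map_add' := fun x y => by
        show f0 (x + y) 0 / γ = f0 x 0 / γ + f0 y 0 / γ
        have := (hadd x 0 y 0).1
        rw [add_zero] at this
        rw [this, add_div] }
  have hσ : ∀ x, f0 x 0 = γ * σ x := by
    intro x
    show _ = γ * (f0 x 0 / γ)
    field_simp
  have hβ : ∀ x, f0 0 x = σ x * f0 0 1 ∧ f1 0 x = σ x * f1 0 1 := by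
    intro x
    have key : ∀ s b, f0 0 (s * b) = σ b * f0 0 s ∧ f1 0 (s * b) = σ b * f1 0 s := by
      intro s b
      obtain ⟨n0, n1, hn⟩ := hlow s
      have aux : ∀ b, f0 0 (s * b) = (n0 - 1) * f0 b 0 ∧ f1 0 (s * b) = n1.2.1 * f0 b 0 := by
        intro b
        have e1 := hn b
        have e2 := hadd b 0 0 (s * b)
        simp only [zero_add, add_zero, g1, mul_zero] at e1 e2
        rw [e1.1, e1.2] at e2
        constructor
        · linear_combination -e2.1
        · linear_combination -e2.2
      have k1 := aux b
      have k2 := aux 1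
      rw [mul_one] at k2
      rw [k1.1, k1.2, k2.1, k2.2, hσ b, ← hγ]
      constructor <;> ring
    have := key 1 x
    simpa using this
  have β0 : f1 0 1 ≠ 0 := by
    intro h
    apply γ0
    rw [hγ, gx, h, mul_zero]
  have hfall : ∀ b c, f0 b c = γ * σ b + f0 0 1 * σ c ∧ f1 b c = f1 0 1 * σ c := by
    intro b c
    have := hadd b 0 0 c
    simp only [zero_add, add_zero] at this
    rw [this.1, this.2, g1, (hβ c).1, (hβ c).2, hσ]
    constructor <;> ring
  refine ⟨σ, (!![γ, f0 0 1; 0, f1 0 1])⁻¹, ?_, ?_, ?_⟩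
  · have hd : (!![γ, f0 0 1; 0, f1 0 1]).det ≠ 0 := by
      rw [Matrix.det_fin_two]; simp [γ0, β0]
    rw [Matrix.det_nonsing_inv]
    exact (Ne.isUnit hd).ringInverse.ne_zero
  · have hit : ∀ n : ℕ, ∃ c : F, ∀ x, (φ ^ n) (mk3 (un 0 x 0)) = mk3 (un 0 (c * σ^[n] x) 0) := by
      intro n
      induction n with
      | zero => exact ⟨1, fun x => by simp⟩
      | succ n ih =>
        obtain ⟨c, hc⟩ := ih
        refine ⟨c * σ^[n] γ, fun x => ?_⟩
        rw [pow_succ, MulAut.mul_apply, hf, g1, hσ, hc, Function.iterate_succ_apply, ← RingHom.coe_pow, map_mul, mul_assoc]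
    obtain ⟨c, hc⟩ := hit N
    rw [hφ] at hc
    have hc' : ∀ x, x = c * σ^[N] x := fun x => (mkun_inj h3 (hc x)).2.1
    have c1 : c = 1 := by
      have := hc' 1
      rw [← RingHom.coe_pow, map_one, mul_one] at this
      exact this.symm
    intro x
    have := hc' x
    rw [c1, one_mul] at this
    exact this.symm
  · intro g hg
    obtain ⟨g', hg'⟩ := mk3_surj (φ (mk3 g))
    refine ⟨g', hP g hg g' hg'.symm, hg'.symm, ?_⟩
    have hd : IsUnit (!![γ, f0 0 1; 0, f1 0 1]).det := by
      rw [Matrix.det_fin_two]; simp [γ0, β0]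
    have e : !![γ, f0 0 1; 0, f1 0 1] * (rho g).map σ = rho g' * !![γ, f0 0 1; 0, f1 0 1] := by
      have k1 := hact g hg g' hg'.symm 1 0
      have k2 := hact g hg g' hg'.symm 0 1
      simp only [mul_one, mul_zero, add_zero, zero_add] at k1 k2
      rw [(hfall (rho g 0 0) _).1, (hfall (rho g 0 0) _).2, g1, ← hγ] at k1
      rw [(hfall (rho g 0 1) _).1, (hfall (rho g 0 1) _).2] at k2
      ext i j
      fin_cases i <;> fin_cases j <;> simp [Matrix.mul_apply, Fin.sum_univ_two]
      · linear_combination k1.1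
      · linear_combination k2.1
      · linear_combination k1.2
      · linear_combination k2.2
    have e' := congrArg (fun M => (!![γ, f0 0 1; 0, f1 0 1])⁻¹ * M * (!![γ, f0 0 1; 0, f1 0 1])⁻¹) e
    simp only [← Matrix.mul_assoc, Matrix.nonsing_inv_mul _ hd, Matrix.one_mul] at e'
    rw [e', Matrix.mul_assoc _ _ (!![γ, f0 0 1; 0, f1 0 1])⁻¹, Matrix.mul_nonsing_inv _ hd, Matrix.mul_one]

end AutStr2


section Assemble

theorem exists_nu (E : Type) [Field E] [Fintype E] (h1 : (-1 : E) ≠ 1) :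
    ∃ (ν : MulChar E ℂ) (m : ℕ), ν (-1) = -1 ∧ ν ^ (2 ^ (m + 1)) = 1 := by
  obtain ⟨χ, hχ⟩ := MulChar.exists_apply_ne_one_of_hasEnoughRootsOfUnity E ℂ h1
  have hm : χ (-1) = -1 := by
    have : χ (-1) * χ (-1) = 1 := by rw [← map_mul]; simp
    exact (mul_self_eq_one_iff.1 this).resolve_left hχ
  obtain ⟨m, t, ht, he⟩ := Nat.exists_eq_two_pow_mul_odd (MulChar.orderOf_pos χ).ne'
  refine ⟨χ ^ t, m, ?_, ?_⟩
  · rw [MulChar.pow_apply' _ ht.pos.ne', hm, ht.neg_one_pow]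
  · rw [← pow_mul]
    apply orderOf_dvd_iff_pow_eq_one.1
    rw [he]
    exact ⟨2, by ring⟩

theorem exists_psi (F : Type) [Field F] [Fintype F] (p : ℕ) [Fact p.Prime] [Algebra (ZMod p) F] :
    ∃ ψ : AddChar F ℂ, ψ ≠ 1 ∧ ∀ (e : F ≃ₐ[ZMod p] F) (x : F), ψ (e x) = ψ x := by
  let ψ : AddChar F ℂ := (ZMod.stdAddChar (N := p)).compAddMonoidHom (Algebra.trace (ZMod p) F).toAddMonoidHom
  have hψ : ∀ x, ψ x = ZMod.stdAddChar (Algebra.trace (ZMod p) F x) := fun x => rfl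
  refine ⟨ψ, ?_, fun e x => ?_⟩
  · intro h
    have htr := (traceForm_nondegenerate (ZMod p) F).1 1
    apply one_ne_zero (htr fun b => ?_)
    rw [Algebra.traceForm_apply]
    apply ZMod.injective_stdAddChar
    rw [← hψ, h]
    simp
  · rw [hψ, hψ, Algebra.trace_eq_of_algEquiv]

theorem sigma_pow (F : Type) [Field F] [Fintype F] (p : ℕ) [Fact p.Prime] [Algebra (ZMod p) F] [CharP F p]
    (σ : F →+* F) : ∃ (e : F ≃ₐ[ZMod p] F) (j : ℕ), ∀ x, σ x = e x ∧ σ x = x ^ p ^ j := by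
  have hcomm : ∀ r : ZMod p, σ (algebraMap (ZMod p) F r) = algebraMap (ZMod p) F r := fun r => by
    show (σ.comp (algebraMap (ZMod p) F)) r = _
    rw [Subsingleton.elim (σ.comp (algebraMap (ZMod p) F)) (algebraMap (ZMod p) F)]
  let f : F →ₐ[ZMod p] F := { σ with commutes' := hcomm }
  let e : F ≃ₐ[ZMod p] F := AlgEquiv.ofBijective f (Finite.injective_iff_bijective.1 σ.injective)
  obtain ⟨j, hj⟩ := FiniteField.exists_forall_apply_eq_pow (ZMod p) p F e
  refine ⟨e, j, fun x => ⟨rfl, ?_⟩⟩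
  have := hj x
  rw [Nat.card_zmod] at this
  exact this

theorem sigma_lift (F : Type) [Field F] [Fintype F] (p : ℕ) (σ : F →+* F) (j N m : ℕ) (hj : ∀ x, σ x = x ^ p ^ j)
    (hσ : ∀ x, σ^[N] x = x) (hN : Odd N) (hp : Odd p) :
    ∃ n : ℕ, (∀ x, σ x = x ^ p ^ n) ∧ p ^ n ≡ 1 [MOD 2 ^ (m + 1)] := by
  set u := (2 ^ (m + 1)) ^ N.totient with hu
  have u0 : 2 ^ (m + 1) ∣ u := dvd_pow_self _ (Nat.totient_pos.2 hN.pos).ne'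
  have u1 : u ≡ 1 [MOD N] := by
    apply Nat.ModEq.pow_totient
    exact Nat.Coprime.pow_left _ (Nat.coprime_two_left.2 hN)
  have up : 1 ≤ u := Nat.pos_of_ne_zero (by positivity)
  obtain ⟨t, ht⟩ := (Nat.modEq_iff_dvd' up).1 u1.symm
  have hu' : u = N * t + 1 := by omega
  have hit : ∀ (r : ℕ) x, σ^[r] x = x ^ p ^ (j * r) := by
    intro r
    induction r with
    | zero => intro x; simp
    | succ r ih =>
      intro x
      rw [Function.iterate_succ_apply, ih, hj, ← pow_mul, ← pow_add]
      congr 2; ring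
  refine ⟨j * u, fun x => ?_, ?_⟩
  · rw [← hit, hu', Function.iterate_succ_apply, Function.iterate_mul]
    have : σ^[N] = id := funext hσ
    rw [this]; simp
  · have h2 : (2 ^ (m + 1)).totient ∣ j * u := by
      rw [Nat.totient_prime_pow_succ Nat.prime_two]
      refine Dvd.dvd.mul_left (dvd_trans ⟨2, ?_⟩ u0) j
      ring
    obtain ⟨r, hr⟩ := h2
    rw [hr, pow_mul]
    have := (Nat.ModEq.pow_totient (x := p) (n := 2 ^ (m + 1))
      (Nat.Coprime.pow_right _ (Nat.coprime_two_right.2 hp))).pow r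
    simpa using this

theorem chi2 {F : Type} [Field F] [Fintype F] (h3 : (3 : F) ≠ 0) (p : ℕ) [Fact p.Prime] [Algebra (ZMod p) F]
    [CharP F p] (hp5 : 5 ≤ p) :
    ∃ χ : FDRep ℂ (PS F), Simple χ ∧
      Module.finrank ℂ χ = (Nat.card F - 1) * (Nat.card F ^ 2 + Nat.card F + 1) ∧
      ∀ φ : MulAut (PS F), (∃ k : ℕ, orderOf φ = p ^ k) → ∀ s, χ.character (φ s) = χ.character s := by
  classical
  have hpp : p.Prime := Fact.out
  have hodd : Odd p := hpp.odd_of_ne_two (by omega)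
  let E : Type := FiniteField.Extension F p 2
  letI : Fintype E := Fintype.ofFinite E
  have h2 : Module.finrank F E = 2 := FiniteField.finrank_extension F p 2
  haveI : CharP E p := charP_of_injective_algebraMap (algebraMap F E).injective p
  haveI : ExpChar E p := ExpChar.prime hpp
  have hm1 : (-1 : E) ≠ 1 := by
    apply Ring.neg_one_ne_one_of_char_ne_two
    rw [ringChar.eq E p]; omega
  obtain ⟨ν, m, hν, hνm⟩ := exists_nu E hm1
  obtain ⟨ψ, hψ, hψe⟩ := exists_psi F p
  have hq : 1 < Nat.card F := Finite.one_lt_card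
  refine ⟨FDRep.of (Representation.coind (m2 E) (tau2 h2 hψ ν)), chi2_irr h2 hψ ν hν hq,
    chi2_finrank h2 hψ ν hν, ?_⟩
  rintro φ ⟨k, hk⟩ s
  obtain ⟨s0, hs0⟩ := sylow_fix p φ k hk
  set φ' := MulAut.conj s0 * φ * (MulAut.conj s0)⁻¹ with hφ'
  have hφN : φ' ^ (p ^ k) = 1 := by
    rw [hφ', conj_pow, ← hk, pow_orderOf_eq_one, mul_one, mul_inv_cancel]
  obtain ⟨σ, B, hB, hσ, hP⟩ := aut_struct h3 φ' hs0 (p ^ k) hodd.pow hφN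
  obtain ⟨e, j, hej⟩ := sigma_pow F p σ
  obtain ⟨n, hn, hnm⟩ := sigma_lift F p σ j (p ^ k) m (fun x => (hej x).2) hσ hodd.pow hodd
  have hνp : ν ^ (p ^ n) = ν := by
    conv_rhs => rw [← pow_one ν]
    rw [pow_eq_pow_iff_modEq]
    exact hnm.of_dvd (orderOf_dvd_iff_pow_eq_one.2 hνm)
  have inv' := chi2_inv h2 hψ ν φ' σ (iterateFrobenius E p n)
    (fun z => by rw [iterateFrobenius_def, map_pow, hn])
    (fun z => by
      apply (algebraMap F E).injective
      rw [hn, map_pow, alg_trace h2, alg_trace h2, iterateFrobenius_def, ← iterateFrobenius_def, ← iterateFrobenius_def,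
        map_add]
      congr 1
      show (iterateFrobenius E p n z) ^ Fintype.card F = iterateFrobenius E p n (z ^ Fintype.card F)
      rw [map_pow])
    (fun c => by rw [hn, map_pow, iterateFrobenius_def])
    (fun x => by rw [(hej x).1, hψe])
    (fun z => by
      rw [iterateFrobenius_def, map_pow, ← MulChar.pow_apply' _ (pow_ne_zero _ hpp.ne_zero), hνp])
    B hB hP
  have e1 : φ s = s0⁻¹ * φ' (s0 * s * s0⁻¹) * s0⁻¹⁻¹ := by
    rw [hφ']
    simp only [MulAut.mul_apply, MulAut.conj_apply, MulAut.conj_inv_apply]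
    simp only [mul_assoc, inv_mul_cancel_left, inv_mul_cancel, mul_one, inv_inv]
  rw [e1, FDRep.char_conj, inv', FDRep.char_conj]

end Assemble

theorem stmt13 (p : ℕ) [Fact p.Prime] (hp5 : 5 ≤ p) (a : ℕ) (ha : 1 ≤ a) :
    ∃ χ₁ χ₂ : FDRep ℂ (PSL 3 p a), Simple χ₁ ∧ Simple χ₂ ∧
      Module.finrank ℂ χ₁ = (p ^ a + 1) * ((p ^ a) ^ 2 + p ^ a + 1) ∧
      Module.finrank ℂ χ₂ = (p ^ a - 1) * ((p ^ a) ^ 2 + p ^ a + 1) ∧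
      ¬ p ∣ Module.finrank ℂ χ₁ ∧ ¬ p ∣ Module.finrank ℂ χ₂ ∧
      (∃ A : FDRep ℂ (MulAut (PSL 3 p a)), ∀ s : PSL 3 p a,
        A.character (MulAut.conj s) = χ₁.character s) ∧
      (∀ φ : MulAut (PSL 3 p a), (∃ k : ℕ, orderOf φ = p ^ k) →
        ∀ s : PSL 3 p a, χ₂.character (φ s) = χ₂.character s) := by
  have hpp : p.Prime := Fact.out
  letI : Fintype (GaloisField p a) := Fintype.ofFinite _
  have h3 : (3 : GaloisField p a) ≠ 0 := by
    intro h
    have h' : ((3 : ℕ) : GaloisField p a) = 0 := by exact_mod_cast h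
    rw [CharP.cast_eq_zero_iff (GaloisField p a) p] at h'
    have := Nat.le_of_dvd (by norm_num) h'
    omega
  have hc : Nat.card (GaloisField p a) = p ^ a := GaloisField.card p a (by omega)
  obtain ⟨χ₁, A, s1, d1, hA⟩ := chi1 h3 p hp5
  obtain ⟨χ₂, s2, d2, hI⟩ := chi2 h3 p hp5
  rw [hc] at d1 d2
  have hd : p ∣ p ^ a := dvd_pow_self p (by omega)
  have q1 : 1 ≤ p ^ a := Nat.one_le_pow _ _ hpp.pos
  have n1 : ¬ p ∣ p ^ a + 1 := fun h => hpp.one_lt.ne' (Nat.dvd_one.1 ((Nat.dvd_add_right hd).1 h))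
  have n2 : ¬ p ∣ (p ^ a) ^ 2 + p ^ a + 1 := fun h => hpp.one_lt.ne'
    (Nat.dvd_one.1 ((Nat.dvd_add_right (dvd_add (dvd_pow hd two_ne_zero) hd)).1 h))
  have n3 : ¬ p ∣ p ^ a - 1 := fun h => hpp.one_lt.ne' (Nat.dvd_one.1 (by
    have := (Nat.dvd_add_right h).1 (by rw [Nat.sub_add_cancel q1]; exact hd)
    exact this))
  refine ⟨χ₁, χ₂, s1, s2, d1, d2, ?_, ?_, ⟨A, hA⟩, hI⟩
  · rw [d1, hpp.dvd_mul]; tauto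
  · rw [d2, hpp.dvd_mul]; tauto
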